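/- arXiv:1307.6174 — 4 statements merged into one kernel-verified Lean document; each statement's English description precedes it below -/
import Mathlib

section
/- For every positive integer d, there are only finitely many imaginary quadratic fields with class number equal to d; equivalently, the set of squarefree integers m < 0 such that the class number of the number field ℚ(√m) equals d is finite. -/
/-- The field ℚ(√m), realized as the subfield of ℂ generated over ℚ by the
square roots of `m`. -/
noncomputable def Qsqrt (m : ℤ) : IntermediateField ℚ ℂ :=
  IntermediateField.adjoin ℚ {z : ℂ | z ^ 2 = (m : ℂ)}

open Finset Filter Topology

namespace HB

/-- Twist by n^(-s). -/
noncomputable def tw (f : ArithmeticFunction ℝ) (s : ℝ) : ArithmeticFunction ℝ :=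
  ⟨fun n => f n * (n : ℝ) ^ (-s), by simp⟩

lemma tw_apply (f : ArithmeticFunction ℝ) (s : ℝ) (n : ℕ) : tw f s n = f n * (n : ℝ) ^ (-s) := rfl

lemma tw_mul (f g : ArithmeticFunction ℝ) (s : ℝ) : tw (f * g) s = tw f s * tw g s := by
  ext n
  rw [tw_apply, ArithmeticFunction.mul_apply, ArithmeticFunction.mul_apply, sum_mul]
  refine sum_congr rfl fun x hx => ?_
  rw [tw_apply, tw_apply]
  obtain ⟨h, -⟩ := Nat.mem_divisorsAntidiagonal.mp hx
  rw [← h, Nat.cast_mul, Real.mul_rpow (Nat.cast_nonneg _) (Nat.cast_nonneg _)]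
  ring

/-- Partial sum. -/
noncomputable def S (f : ArithmeticFunction ℝ) (s : ℝ) (N : ℕ) : ℝ := ∑ n ∈ Ioc 0 N, tw f s n

/-- Limit of partial sums. -/
noncomputable def Lf (f : ArithmeticFunction ℝ) (s : ℝ) : ℝ := limUnder atTop (fun N => S f s N)

/-- Abel bound. -/
lemma abel_bound (g w : ℕ → ℝ) (B : ℝ) (N : ℕ) (hw : ∀ n, N < n → w (n + 1) ≤ w n)
    (hg : ∀ M, N ≤ M → ∑ n ∈ Ioc N M, g n ≤ B) (M : ℕ) (hM : N < M) :
    ∑ n ∈ Ioc N M, g n * w n ≤ w M * ∑ n ∈ Ioc N M, g n + B * (w (N + 1) - w M) := by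
  induction M, hM using Nat.le_induction with
  | base => simp [mul_comm]
  | succ M hM ih =>
    rw [← Finset.sum_Ioc_consecutive (fun n => g n * w n) (by omega : N ≤ M) (by omega : M ≤ M + 1),
      ← Finset.sum_Ioc_consecutive (fun n => g n) (by omega : N ≤ M) (by omega : M ≤ M + 1)]
    have h1 := hw M (by omega)
    have h2 := hg M (by omega)
    simp only [Nat.Ioc_succ_singleton, sum_singleton]
    nlinarith [mul_nonneg (sub_nonneg.2 h1) (sub_nonneg.2 h2)]

/-- Abel comparison. -/
lemma abel_compare (g w : ℕ → ℝ) (hw : ∀ n, 0 < n → w (n + 1) ≤ w n) (hw0 : ∀ n, 0 ≤ w n)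
    (hg : ∀ M, 0 ≤ ∑ n ∈ Ioc 0 M, g n) (M : ℕ) :
    0 ≤ ∑ n ∈ Ioc 0 M, g n * w n := by
  rcases Nat.eq_zero_or_pos M with rfl | hM
  · simp
  have := abel_bound (fun n => - g n) w 0 0 hw (fun M _ => by
    simpa using hg M) M hM
  simp only [neg_mul, sum_neg_distrib, zero_mul, add_zero] at this
  nlinarith [mul_nonneg (hw0 M) (hg M)]

lemma rpow_anti (s : ℝ) (hs : 0 ≤ s) (n : ℕ) (hn : 0 < n) :
    ((n + 1 : ℕ) : ℝ) ^ (-s) ≤ (n : ℝ) ^ (-s) := by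
  apply Real.rpow_le_rpow_of_nonpos (by positivity) (by push_cast; linarith) (by linarith)

lemma S_diff (f : ArithmeticFunction ℝ) (A : ℝ) (hA : ∀ k, |∑ n ∈ Ioc 0 k, f n| ≤ A)
    (s : ℝ) (hs : 0 ≤ s) (N M : ℕ) (h : N ≤ M) :
    |S f s M - S f s N| ≤ 2 * A * ((N + 1 : ℕ) : ℝ) ^ (-s) := by
  have hA0 : 0 ≤ A := (abs_nonneg _).trans (hA 0)
  rcases h.eq_or_lt with rfl | h
  · simp; positivity
  have e : S f s M - S f s N = ∑ n ∈ Ioc N M, f n * (n : ℝ) ^ (-s) := by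
    rw [S, S, ← Finset.sum_Ioc_consecutive _ (Nat.zero_le N) h.le]
    simp [tw_apply]
  have hd : ∀ M, N ≤ M → |∑ n ∈ Ioc N M, f n| ≤ 2 * A := by
    intro M hM
    have : ∑ n ∈ Ioc N M, f n = ∑ n ∈ Ioc 0 M, f n - ∑ n ∈ Ioc 0 N, f n := by
      rw [← Finset.sum_Ioc_consecutive _ (Nat.zero_le N) hM]; ring
    rw [this]
    have h1 := abs_le.1 (hA M)
    have h2 := abs_le.1 (hA N)
    exact abs_le.2 ⟨by linarith, by linarith⟩
  have hw : ∀ n, N < n → ((n + 1 : ℕ) : ℝ) ^ (-s) ≤ (n : ℝ) ^ (-s) :=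
    fun n hn => rpow_anti s hs n (by omega)
  have b1 := abel_bound (fun n => f n) (fun n => (n : ℝ) ^ (-s)) (2 * A) N hw
    (fun M hM => (abs_le.1 (hd M hM)).2) M h
  have b2 := abel_bound (fun n => - f n) (fun n => (n : ℝ) ^ (-s)) (2 * A) N hw
    (fun M hM => by have := (abs_le.1 (hd M hM)).1; rw [sum_neg_distrib]; linarith) M h
  have hwM : 0 ≤ (M : ℝ) ^ (-s) := by positivity
  have hM := abs_le.1 (hd M h.le)
  rw [e, abs_le]
  simp only [neg_mul, sum_neg_distrib] at b1 b2
  constructor <;> nlinarith [mul_nonneg hwM (sub_nonneg.2 hM.1), mul_nonneg hwM (sub_nonneg.2 hM.2)]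

lemma S_tendsto (f : ArithmeticFunction ℝ) (A : ℝ) (hA : ∀ k, |∑ n ∈ Ioc 0 k, f n| ≤ A)
    (s : ℝ) (hs : 0 < s) : Tendsto (fun N => S f s N) atTop (𝓝 (Lf f s)) := by
  apply CauchySeq.tendsto_limUnder
  have ht : Tendsto (fun N : ℕ => 2 * A * ((N + 1 : ℕ) : ℝ) ^ (-s)) atTop (𝓝 0) := by
    have := (tendsto_rpow_neg_atTop hs).comp
      (tendsto_natCast_atTop_atTop.comp (tendsto_add_atTop_nat 1))
    simpa using this.const_mul (2 * A)
  refine cauchySeq_of_le_tendsto_0' _ (fun N M h => ?_) ht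
  rw [dist_comm, Real.dist_eq]
  exact S_diff f A hA s hs.le N M h

lemma L_diff (f : ArithmeticFunction ℝ) (A : ℝ) (hA : ∀ k, |∑ n ∈ Ioc 0 k, f n| ≤ A)
    (s : ℝ) (hs : 0 < s) (N : ℕ) :
    |Lf f s - S f s N| ≤ 2 * A * ((N + 1 : ℕ) : ℝ) ^ (-s) := by
  have := ((S_tendsto f A hA s hs).sub_const (S f s N)).abs
  refine le_of_tendsto this ?_
  filter_upwards [eventually_ge_atTop N] with M hM
  exact S_diff f A hA s hs.le N M hM

lemma L_cont (f : ArithmeticFunction ℝ) (A : ℝ) (hA : ∀ k, |∑ n ∈ Ioc 0 k, f n| ≤ A)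
    (s₀ : ℝ) (hs : 0 < s₀) : ContinuousOn (Lf f) (Set.Ici s₀) := by
  have hA0 : 0 ≤ A := (abs_nonneg _).trans (hA 0)
  have ht : Tendsto (fun N : ℕ => 2 * A * ((N + 1 : ℕ) : ℝ) ^ (-s₀)) atTop (𝓝 0) := by
    have := (tendsto_rpow_neg_atTop hs).comp
      (tendsto_natCast_atTop_atTop.comp (tendsto_add_atTop_nat 1))
    simpa using this.const_mul (2 * A)
  have hu : TendstoUniformlyOn (fun N s => S f s N) (Lf f) atTop (Set.Ici s₀) := by
    rw [Metric.tendstoUniformlyOn_iff]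
    intro ε hε
    filter_upwards [ht.eventually (gt_mem_nhds hε)] with N hN s hs'
    rw [Real.dist_eq]
    refine lt_of_le_of_lt (L_diff f A hA s (lt_of_lt_of_le hs hs') N) (lt_of_le_of_lt ?_ hN)
    gcongr
    · simp
    · exact hs'
  refine hu.continuousOn (Frequently.of_forall fun N => ?_)
  unfold S
  refine continuousOn_finsetSum _ fun n hn => ?_
  simp only [tw_apply]
  have : (n : ℝ) ≠ 0 := by
    have := (mem_Ioc.1 hn).1
    positivity
  apply Continuous.continuousOn
  refine continuous_const.mul ?_
  exact (Real.continuous_const_rpow this).comp continuous_neg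

lemma hyperbola (F : ℕ × ℕ → ℝ) (K : ℕ) :
    ∑ x ∈ Ioc 0 (K^2) ×ˢ Ioc 0 (K^2) with x.1 * x.2 ≤ K^2, F x
    = ∑ i ∈ Ioc 0 K, ∑ j ∈ Ioc 0 (K^2 / i), F (i, j)
      + ∑ j ∈ Ioc 0 K, ∑ i ∈ Ioc 0 (K^2 / j), F (i, j)
      - ∑ i ∈ Ioc 0 K, ∑ j ∈ Ioc 0 K, F (i, j) := by
  classical
  have e1 : ∑ i ∈ Ioc 0 K, ∑ j ∈ Ioc 0 (K^2 / i), F (i, j)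
      = ∑ x ∈ {x ∈ Ioc 0 (K^2) ×ˢ Ioc 0 (K^2) | x.1 * x.2 ≤ K^2} with x.1 ≤ K, F x := by
    rw [Finset.sum_sigma']
    refine Finset.sum_bij' (fun x _ => (x.1, x.2)) (fun x _ => ⟨x.1, x.2⟩) ?_ ?_ ?_ ?_ ?_
    · rintro ⟨i, j⟩ h
      simp only [mem_sigma, mem_Ioc, mem_filter, mem_product] at h ⊢
      obtain ⟨⟨h1, h2⟩, h3, h4⟩ := h
      have := (Nat.le_div_iff_mul_le h1).1 h4
      refine ⟨⟨⟨⟨h1, ?_⟩, h3, ?_⟩, by nlinarith⟩, h2⟩ <;> nlinarith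
    · rintro ⟨i, j⟩ h
      simp only [mem_sigma, mem_Ioc, mem_filter, mem_product] at h ⊢
      obtain ⟨⟨⟨⟨h1, h2⟩, h3, h4⟩, h5⟩, h6⟩ := h
      exact ⟨⟨h1, h6⟩, h3, (Nat.le_div_iff_mul_le h1).2 (by nlinarith)⟩
    · simp
    · simp
    · simp
  have e2 : ∑ j ∈ Ioc 0 K, ∑ i ∈ Ioc 0 (K^2 / j), F (i, j)
      = ∑ x ∈ {x ∈ Ioc 0 (K^2) ×ˢ Ioc 0 (K^2) | x.1 * x.2 ≤ K^2} with x.2 ≤ K, F x := by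
    rw [Finset.sum_sigma']
    refine Finset.sum_bij' (fun x _ => (x.2, x.1)) (fun x _ => ⟨x.2, x.1⟩) ?_ ?_ ?_ ?_ ?_
    · rintro ⟨i, j⟩ h
      simp only [mem_sigma, mem_Ioc, mem_filter, mem_product] at h ⊢
      obtain ⟨⟨h1, h2⟩, h3, h4⟩ := h
      have := (Nat.le_div_iff_mul_le h1).1 h4
      refine ⟨⟨⟨⟨h3, ?_⟩, h1, ?_⟩, by nlinarith⟩, h2⟩ <;> nlinarith
    · rintro ⟨i, j⟩ h
      simp only [mem_sigma, mem_Ioc, mem_filter, mem_product] at h ⊢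
      obtain ⟨⟨⟨⟨h1, h2⟩, h3, h4⟩, h5⟩, h6⟩ := h
      exact ⟨⟨h3, h6⟩, h1, (Nat.le_div_iff_mul_le h3).2 (by nlinarith)⟩
    · simp
    · simp
    · simp
  have e3 : ∑ i ∈ Ioc 0 K, ∑ j ∈ Ioc 0 K, F (i, j)
      = ∑ x ∈ {x ∈ Ioc 0 (K^2) ×ˢ Ioc 0 (K^2) | x.1 * x.2 ≤ K^2} with (x.1 ≤ K ∧ x.2 ≤ K), F x := by
    rw [← Finset.sum_product']
    refine Finset.sum_congr ?_ fun _ _ => rfl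
    ext ⟨i, j⟩
    simp only [mem_Ioc, mem_filter, mem_product]
    constructor
    · rintro ⟨⟨h1, h2⟩, h3, h4⟩
      refine ⟨⟨⟨⟨h1, ?_⟩, h3, ?_⟩, ?_⟩, h2, h4⟩ <;> nlinarith
    · rintro ⟨⟨⟨⟨h1, h2⟩, h3, h4⟩, h5⟩, h6, h7⟩
      exact ⟨⟨h1, h6⟩, h3, h7⟩
  rw [e1, e2, e3, eq_sub_iff_add_eq]
  rw [Finset.sum_filter (fun x : ℕ × ℕ => x.1 ≤ K ∧ x.2 ≤ K), Finset.sum_filter (fun x : ℕ × ℕ => x.1 ≤ K),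
    Finset.sum_filter (fun x : ℕ × ℕ => x.2 ≤ K), ← Finset.sum_add_distrib, ← Finset.sum_add_distrib]
  refine Finset.sum_congr rfl ?_
  rintro ⟨i, j⟩ h
  simp only [mem_Ioc, mem_filter, mem_product] at h
  have : i ≤ K ∨ j ≤ K := by
    by_contra! hc
    nlinarith [h.2, hc.1, hc.2]
  by_cases h1 : i ≤ K <;> by_cases h2 : j ≤ K <;> simp [h1, h2] <;> tauto

lemma S_mul (f g : ArithmeticFunction ℝ) (s : ℝ) (N : ℕ) :
    S (f * g) s N = ∑ x ∈ Ioc 0 N ×ˢ Ioc 0 N with x.1 * x.2 ≤ N, tw f s x.1 * tw g s x.2 := by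
  rw [S, tw_mul, ArithmeticFunction.sum_Ioc_mul_eq_sum_prod_filter]

lemma conv_half (f g : ArithmeticFunction ℝ) (B : ℝ)
    (hB : ∀ k, |∑ n ∈ Ioc 0 k, g n| ≤ B) (hf : ∀ n, |f n| ≤ 2) (s : ℝ) (hs : 0 < s) (K : ℕ) (hK : 0 < K) :
    |∑ i ∈ Ioc 0 K, tw f s i * S g s (K^2 / i) - S f s K * Lf g s| ≤ 4 * B * (K : ℝ) ^ (1 - 2 * s) := by
  have hB0 : 0 ≤ B := (abs_nonneg _).trans (hB 0)
  have hK' : (0:ℝ) < K := by positivity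
  rw [S, sum_mul, ← sum_sub_distrib]
  refine (abs_sum_le_sum_abs _ _).trans ?_
  have : ∀ i ∈ Ioc 0 K, |tw f s i * S g s (K^2 / i) - tw f s i * Lf g s| ≤ 4 * B * (K : ℝ) ^ (- (2 * s)) := by
    intro i hi
    have hi0 : 0 < i := (mem_Ioc.1 hi).1
    have hi' : (0:ℝ) < i := by positivity
    rw [← mul_sub, abs_mul, tw_apply, abs_mul, abs_sub_comm]
    have h1 := L_diff g B hB s hs (K^2 / i)
    have h2 : ((K^2 / i + 1 : ℕ) : ℝ) ^ (-s) ≤ ((K:ℝ)^2 / i) ^ (-s) := by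
      apply Real.rpow_le_rpow_of_nonpos (by positivity) _ (by linarith)
      rw [div_le_iff₀ hi']
      have : K ^ 2 ≤ (K ^ 2 / i + 1) * i := by
        rw [mul_comm]; exact (Nat.lt_mul_div_succ (K^2) hi0).le
      exact_mod_cast this
    have h3 : ((K:ℝ)^2 / i) ^ (-s) = (K:ℝ) ^ (-(2*s)) * ((i:ℝ) ^ (-s))⁻¹ := by
      rw [Real.div_rpow (by positivity) (by positivity), ← Real.rpow_natCast, ← Real.rpow_mul hK'.le]
      push_cast; rw [div_eq_mul_inv]; ring_nf
    have h4 : (0:ℝ) < (i:ℝ) ^ (-s) := by positivity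
    rw [abs_of_pos h4]
    calc |f i| * (i:ℝ) ^ (-s) * |Lf g s - S g s (K^2 / i)|
        ≤ 2 * (i:ℝ) ^ (-s) * (2 * B * ((K:ℝ) ^ (-(2*s)) * ((i:ℝ) ^ (-s))⁻¹)) := by
          gcongr
          · exact hf i
          · refine h1.trans ?_
            rw [← h3]; gcongr
      _ = 4 * B * (K : ℝ) ^ (- (2 * s)) := by field_simp; ring
  refine (Finset.sum_le_card_nsmul _ _ _ this).trans ?_
  rw [Nat.card_Ioc, nsmul_eq_mul, sub_eq_add_neg, Real.rpow_add hK', Real.rpow_one]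
  simp only [tsub_zero]
  apply le_of_eq; ring

lemma conv_bound (f g : ArithmeticFunction ℝ) (A B : ℝ) (hA1 : 1 ≤ A) (hB1 : 1 ≤ B)
    (hA : ∀ k, |∑ n ∈ Ioc 0 k, f n| ≤ A)
    (hB : ∀ k, |∑ n ∈ Ioc 0 k, g n| ≤ B) (hf : ∀ n, |f n| ≤ 2) (hg : ∀ n, |g n| ≤ 2)
    (s : ℝ) (hs : 19/20 ≤ s) (K : ℕ) (hK : 0 < K) :
    |S (f * g) s (K^2) - Lf f s * Lf g s| ≤ 12 * A * B * (K : ℝ) ^ (-(9/10) : ℝ) := by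
  have hK' : (0:ℝ) < K := by positivity
  have hK1 : (1:ℝ) ≤ K := by exact_mod_cast hK
  have h1 := conv_half f g B hB hf s (by linarith) K hK
  have h2 := conv_half g f A hA hg s (by linarith) K hK
  have e : S (f * g) s (K^2) = ∑ i ∈ Ioc 0 K, tw f s i * S g s (K^2 / i)
      + ∑ i ∈ Ioc 0 K, tw g s i * S f s (K^2 / i) - S f s K * S g s K := by
    rw [S_mul, hyperbola (fun x => tw f s x.1 * tw g s x.2)]
    simp only [S, mul_sum, sum_mul]
    congr 1
    · congr 1
      refine sum_congr rfl fun _ _ => sum_congr rfl fun _ _ => mul_comm _ _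
    · rw [sum_comm]
  have l1 := L_diff f A hA s (by linarith) K
  have l2 := L_diff g B hB s (by linarith) K
  have hp : ((K + 1 : ℕ) : ℝ) ^ (-s) ≤ (K : ℝ) ^ (-s) := rpow_anti s (by linarith) K hK
  have l3 : |(Lf f s - S f s K) * (Lf g s - S g s K)| ≤ 4 * A * B * (K : ℝ) ^ (1 - 2 * s) := by
    rw [abs_mul]
    calc _ ≤ (2 * A * (K : ℝ) ^ (-s)) * (2 * B * (K : ℝ) ^ (-s)) := by
          gcongr
          · exact l1.trans (by gcongr)
          · exact l2.trans (by gcongr)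
      _ = 4 * A * B * (K : ℝ) ^ (- (2 * s)) := by
          rw [show -(2*s) = -s + -s by ring, Real.rpow_add hK']; ring
      _ ≤ _ := by
          gcongr 4 * A * B * ?_
          exact Real.rpow_le_rpow_of_exponent_le hK1 (by linarith)
  have e2 : S (f * g) s (K^2) - Lf f s * Lf g s
      = (∑ i ∈ Ioc 0 K, tw f s i * S g s (K^2 / i) - S f s K * Lf g s)
       + (∑ i ∈ Ioc 0 K, tw g s i * S f s (K^2 / i) - S g s K * Lf f s)
       - (Lf f s - S f s K) * (Lf g s - S g s K) := by rw [e]; ring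
  rw [e2]
  have hk : (K : ℝ) ^ (1 - 2 * s) ≤ (K : ℝ) ^ (-(9/10) : ℝ) :=
    Real.rpow_le_rpow_of_exponent_le hK1 (by linarith)
  have hk0 : 0 < (K : ℝ) ^ (1 - 2 * s) := by positivity
  have hAB : A ≤ A * B ∧ B ≤ A * B := ⟨by nlinarith, by nlinarith⟩
  calc _ ≤ 4 * B * (K : ℝ) ^ (1 - 2 * s) + 4 * A * (K : ℝ) ^ (1 - 2 * s)
        + 4 * A * B * (K : ℝ) ^ (1 - 2 * s) :=
        (abs_sub _ _).trans (add_le_add ((abs_add_le _ _).trans (add_le_add h1 h2)) l3)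
    _ ≤ 12 * A * B * (K : ℝ) ^ (1 - 2 * s) := by nlinarith [hAB.1, hAB.2]
    _ ≤ _ := by gcongr

end HB
open Finset Filter Topology
open scoped NumberTheorySymbols
namespace HB

/-- The quadratic character n ↦ (m/n) on odd n. -/
noncomputable def chi (m : ℤ) : ArithmeticFunction ℝ :=
  ⟨fun n => if Odd n then ((J(m | n) : ℤ) : ℝ) else 0, by simp⟩

lemma chi_apply (m : ℤ) (n : ℕ) : chi m n = if Odd n then ((J(m | n) : ℤ) : ℝ) else 0 := rfl

lemma chi_one (m : ℤ) : chi m 1 = 1 := by simp [chi_apply]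

lemma chi_mul (m : ℤ) (a b : ℕ) : chi m (a * b) = chi m a * chi m b := by
  simp only [chi_apply, Nat.odd_mul]
  by_cases ha : Odd a <;> by_cases hb : Odd b <;> simp [ha, hb]
  rw [jacobiSym.mul_right' _ (by rintro rfl; simp at ha) (by rintro rfl; simp at hb)]
  simp

lemma chi_vals (m : ℤ) (n : ℕ) : chi m n = 0 ∨ chi m n = 1 ∨ chi m n = -1 := by
  rw [chi_apply]
  split_ifs
  · rcases jacobiSym.trichotomy m n with h | h | h <;> simp [h]
  · simp

lemma chi_abs (m : ℤ) (n : ℕ) : |chi m n| ≤ 1 := by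
  rcases chi_vals m n with h | h | h <;> simp [h]

lemma chi_mod (m : ℤ) (n k : ℕ) (hk : 4 * m.natAbs ∣ k) : chi m (n % k) = chi m n := by
  have h2 : 2 ∣ k := (Dvd.intro _ (by ring : 2 * (2 * m.natAbs) = 4 * m.natAbs)).trans hk
  have : Odd (n % k) ↔ Odd n := by
    rw [Nat.odd_iff, Nat.odd_iff, Nat.mod_mod_of_dvd _ h2]
  simp only [chi_apply, this]
  split_ifs with h
  · rw [jacobiSym.mod_right m h, jacobiSym.mod_right m (this.2 h), Nat.mod_mod_of_dvd _ hk]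
  · rfl

lemma partial_bound (f : ℕ → ℝ) (q : ℕ) (hq : 0 < q) (c : ℝ) (hc : ∀ n, |f n| ≤ c)
    (hp : ∀ n, f (n % q) = f n) (h0 : ∑ n ∈ range q, f n = 0) (k : ℕ) :
    |∑ n ∈ range k, f n| ≤ c * q := by
  have hc0 : 0 ≤ c := (abs_nonneg _).trans (hc 0)
  induction k using Nat.strong_induction_on with
  | _ k ih =>
    rcases lt_or_ge k q with h | h
    · refine (abs_sum_le_sum_abs _ _).trans ?_
      refine (Finset.sum_le_card_nsmul _ _ c fun n _ => hc n).trans ?_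
      rw [card_range, nsmul_eq_mul, mul_comm]
      gcongr
    · obtain ⟨n, rfl⟩ := Nat.exists_eq_add_of_le h
      rw [Finset.sum_range_add, h0, zero_add]
      have : ∀ i, f (q + i) = f i := by
        intro i
        rw [← hp (q + i), Nat.add_mod_left, hp]
      simp only [this]
      exact ih n (by omega)

lemma partial_bound' (f : ArithmeticFunction ℝ) (q : ℕ) (hq : 0 < q) (c : ℝ) (hc : ∀ n, |f n| ≤ c)
    (hp : ∀ n, f (n % q) = f n) (h0 : ∑ n ∈ range q, f n = 0) (k : ℕ) :
    |∑ n ∈ Ioc 0 k, f n| ≤ c * q := by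
  have := partial_bound f q hq c hc hp h0 (k + 1)
  rw [Finset.sum_range_succ', ArithmeticFunction.map_zero, add_zero] at this
  have e : ∀ k : ℕ, ∑ n ∈ Ioc 0 k, f n = ∑ n ∈ range k, f (n + 1) := by
    intro k
    induction k with
    | zero => simp
    | succ k ih => rw [Finset.sum_range_succ, Finset.sum_Ioc_succ_top (Nat.zero_le _), ih]
  rwa [e]

lemma sum_zero (f : ℕ → ℝ) (q n₀ : ℕ) (hq : 0 < q) (hp : ∀ n, f (n % q) = f n)
    (hn : n₀.Coprime q) (h : ∀ n, f (n₀ * n) = - f n) : ∑ n ∈ range q, f n = 0 := by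
  have hinj : Set.InjOn (fun n => n₀ * n % q) (range q : Finset ℕ) := by
    intro a ha b hb hab
    simp only [coe_range, Set.mem_Iio] at ha hb
    have : n₀ * a ≡ n₀ * b [MOD q] := hab
    have := Nat.ModEq.cancel_left_of_coprime (by rw [Nat.gcd_comm]; exact hn) this
    rwa [Nat.ModEq, Nat.mod_eq_of_lt ha, Nat.mod_eq_of_lt hb] at this
  have him : (range q).image (fun n => n₀ * n % q) = range q := by
    apply Finset.eq_of_subset_of_card_le
    · intro x hx
      obtain ⟨y, -, rfl⟩ := mem_image.1 hx
      exact mem_range.2 (Nat.mod_lt _ hq)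
    · rw [card_image_of_injOn hinj]
  have : ∑ n ∈ range q, f n = - ∑ n ∈ range q, f n := by
    conv_lhs => rw [← him, Finset.sum_image hinj]
    rw [← Finset.sum_neg_distrib]
    exact sum_congr rfl fun n _ => by rw [hp, h]
  linarith

lemma chi_neg (m : ℤ) (hm : m < 0) : chi m (4 * m.natAbs - 1) = -1 := by
  set k := m.natAbs with hk
  have hk0 : 0 < k := by omega
  have hmk : m = -(k : ℤ) := by omega
  have hodd : Odd (4 * k - 1) := ⟨2 * k - 1, by omega⟩
  rw [chi_apply, if_pos hodd, hmk, jacobiSym.neg _ hodd, ZMod.χ₄_nat_three_mod_four (by omega)]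
  have h1 : J((k:ℤ) | 4 * k - 1) * J((4:ℤ) | 4 * k - 1) = 1 := by
    rw [← jacobiSym.mul_left]
    have : (k:ℤ) * 4 = 1 + ((4 * k - 1 : ℕ) : ℤ) := by
      push_cast [show 1 ≤ 4 * k by omega]; ring
    rw [jacobiSym.mod_left, this, Int.add_emod_right, ← jacobiSym.mod_left, jacobiSym.one_left]
  have h2 : J((4:ℤ) | 4 * k - 1) = 1 := by
    rw [show (4:ℤ) = 2 ^ 2 by norm_num]
    apply jacobiSym.sq_one'
    rw [Int.gcd_eq_natAbs]
    simpa using (Nat.coprime_two_left.2 hodd)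
  rw [h2, mul_one] at h1
  rw [h1]; norm_num

lemma chi_partial (m : ℤ) (hm : m < 0) (k : ℕ) :
    |∑ n ∈ Ioc 0 k, chi m n| ≤ 4 * m.natAbs := by
  have h := partial_bound' (chi m) (4 * m.natAbs) (by omega) 1 (chi_abs m)
    (fun n => chi_mod m n _ dvd_rfl) (sum_zero _ _ (4 * m.natAbs - 1) (by omega)
      (fun n => chi_mod m n _ dvd_rfl) ?_ ?_) k
  · simpa using h
  · have : 1 ≤ 4 * m.natAbs := by omega
    have h := Nat.coprime_self_sub_right this
    rw [Nat.coprime_comm]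
    exact h.2 (by simp)
  · intro n
    rw [chi_mul, chi_neg m hm]; ring

lemma exists_odd_prime (a b : ℕ) (ha : 0 < a) (hb : Squarefree b) (hab : 2 * a < b) :
    ∃ p, p.Prime ∧ Odd p ∧ p ∣ b ∧ ¬ p ∣ a := by
  by_contra! hc
  have hb0 : b ≠ 0 := by omega
  have hsub : b.primeFactors ⊆ (2 * a).primeFactors := by
    intro p hp
    have hpp := Nat.prime_of_mem_primeFactors hp
    rw [Nat.mem_primeFactors]
    refine ⟨hpp, ?_, by omega⟩
    rcases hpp.eq_two_or_odd' with rfl | ho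
    · exact dvd_mul_right _ _
    · exact Dvd.dvd.mul_left (hc p hpp ho (Nat.dvd_of_mem_primeFactors hp)) _
  have h1 : b ∣ 2 * a := by
    rw [← Nat.prod_primeFactors_of_squarefree hb]
    exact (Finset.prod_dvd_prod_of_subset _ _ _ hsub).trans (Nat.prod_primeFactors_dvd _)
  have := Nat.le_of_dvd (by omega) h1
  omega

lemma chi_eq_one_of_mod (m : ℤ) (n k : ℕ) (hk : 4 * m.natAbs ∣ k) (hn : n ≡ 1 [MOD k]) :
    chi m n = 1 := by
  rw [← chi_mod m n k hk, hn, chi_mod m 1 k hk, chi_one]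

lemma exists_twist (m₁ m₂ : ℤ) (h₁ : m₁ ≠ 0) (h₂ : Squarefree m₂)
    (h : 2 * m₁.natAbs < m₂.natAbs) :
    ∃ n : ℕ, n.Coprime (4 * m₁.natAbs * m₂.natAbs) ∧ chi m₁ n * chi m₂ n = -1 := by
  obtain ⟨p, hp, hpo, hp2, hp1⟩ := exists_odd_prime m₁.natAbs m₂.natAbs (by omega)
    (Int.squarefree_natAbs.2 h₂) h
  have : Fact p.Prime := ⟨hp⟩
  obtain ⟨t, rfl⟩ : (p : ℤ) ∣ m₂ := Int.natCast_dvd.2 hp2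
  have hpt : ¬ p ∣ t.natAbs := by
    intro hd
    have hd' : (p:ℤ) ∣ t := Int.natCast_dvd.2 hd
    have := h₂ (p:ℤ) (mul_dvd_mul_left _ hd')
    rw [Int.isUnit_iff_natAbs_eq, Int.natAbs_natCast] at this
    exact hp.one_lt.ne' this
  have ht0 : t ≠ 0 := by rintro rfl; simp at hpt
  set M := 4 * m₁.natAbs * t.natAbs with hM
  have hcop : p.Coprime M := by
    have h4 : p.Coprime 4 := by
      have : p.Coprime (2^2) := Nat.Coprime.pow_right 2 (Nat.coprime_two_right.2 hpo)
      simpa using this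
    exact (h4.mul_right (hp.coprime_iff_not_dvd.2 hp1)).mul_right (hp.coprime_iff_not_dvd.2 hpt)
  obtain ⟨c, hc⟩ : ∃ c : ZMod p, ¬ IsSquare c := by
    apply FiniteField.exists_nonsquare
    rw [ZMod.ringChar_zmod_n]
    rintro rfl
    exact absurd hpo (by decide)
  obtain ⟨n, hn1, hn2⟩ := Nat.chineseRemainder hcop c.val 1
  have hnc : (n : ZMod p) = c := by
    have := (ZMod.natCast_eq_natCast_iff _ _ _).2 hn1
    rw [this, ZMod.natCast_zmod_val]
  have h4n : n % 4 = 1 := by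
    have : n ≡ 1 [MOD 4] := hn2.of_dvd (by rw [hM, mul_assoc]; exact dvd_mul_right _ _)
    exact this
  have hnodd : Odd n := by rw [Nat.odd_iff]; omega
  have hcn : n.Coprime (M * p) := by
    refine Nat.Coprime.mul_right ?_ ?_
    · rw [Nat.Coprime, hn2.gcd_eq]; simp
    · rw [Nat.coprime_comm, hp.coprime_iff_not_dvd]
      intro hd
      have : (n : ZMod p) = 0 := (ZMod.natCast_eq_zero_iff _ _).2 hd
      rw [hnc] at this
      exact hc (this ▸ IsSquare.zero)
  refine ⟨n, ?_, ?_⟩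
  · rw [Int.natAbs_mul, Int.natAbs_natCast]
    convert hcn using 1
    rw [hM]; ring
  · have e1 : chi m₁ n = 1 := chi_eq_one_of_mod m₁ n M (dvd_mul_right _ _) hn2
    have e2 : chi t n = 1 := chi_eq_one_of_mod t n M ⟨m₁.natAbs, by rw [hM]; ring⟩ hn2
    rw [chi_apply, if_pos hnodd] at e2
    rw [e1, one_mul, chi_apply, if_pos hnodd, jacobiSym.mul_left, Int.cast_mul, e2, mul_one,
      jacobiSym.quadratic_reciprocity_one_mod_four' hpo h4n, ← jacobiSym.legendreSym.to_jacobiSym,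
      (legendreSym.eq_neg_one_iff p).2 (by rw [Int.cast_natCast, hnc]; exact hc)]
    simp

lemma prod_partial (m₁ m₂ : ℤ) (h₁ : m₁ ≠ 0) (h₂ : Squarefree m₂)
    (h : 2 * m₁.natAbs < m₂.natAbs) (k : ℕ) :
    |∑ n ∈ Ioc 0 k, ((chi m₁).pmul (chi m₂)) n| ≤ 4 * m₁.natAbs * m₂.natAbs := by
  obtain ⟨n₀, hc, hn⟩ := exists_twist m₁ m₂ h₁ h₂ h
  set q := 4 * m₁.natAbs * m₂.natAbs with hq
  have hq0 : 0 < q := by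
    have : 0 < m₁.natAbs := by omega
    have : 0 < m₂.natAbs := by omega
    positivity
  have hp : ∀ n, ((chi m₁).pmul (chi m₂)) (n % q) = ((chi m₁).pmul (chi m₂)) n := by
    intro n
    rw [ArithmeticFunction.pmul_apply, ArithmeticFunction.pmul_apply,
      chi_mod m₁ n q (dvd_mul_right _ _), chi_mod m₂ n q ⟨m₁.natAbs, by rw [hq]; ring⟩]
  have h := partial_bound' ((chi m₁).pmul (chi m₂)) q hq0 1 (fun n => by
    rw [ArithmeticFunction.pmul_apply, abs_mul]
    exact mul_le_one₀ (chi_abs _ _) (abs_nonneg _) (chi_abs _ _)) hp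
    (sum_zero _ _ n₀ hq0 hp hc ?_) k
  · rw [one_mul, hq] at h
    exact_mod_cast h
  · intro n
    simp only [ArithmeticFunction.pmul_apply, chi_mul]
    linear_combination chi m₁ n * chi m₂ n * hn

end HB
open Finset Filter Topology
open scoped NumberTheorySymbols
namespace HB

/-- Indicator of odd numbers. -/
noncomputable def oddz : ArithmeticFunction ℝ := ⟨fun n => if Odd n then 1 else 0, by simp⟩

lemma oddz_apply (n : ℕ) : oddz n = if Odd n then 1 else 0 := rfl

lemma oddz_mul (a b : ℕ) : oddz (a * b) = oddz a * oddz b := by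
  simp only [oddz_apply, Nat.odd_mul]
  by_cases ha : Odd a <;> by_cases hb : Odd b <;> simp [ha, hb]

lemma oddz_one : oddz 1 = 1 := by simp [oddz_apply]

/-- r m n counts divisors weighted by chi. -/
noncomputable def r (m : ℤ) : ArithmeticFunction ℝ := oddz * chi m

/-- The real Moebius function. -/
noncomputable def muR : ArithmeticFunction ℝ := ((ArithmeticFunction.moebius : ArithmeticFunction ℤ) : ArithmeticFunction ℝ)

/-- Inverse of r. -/
noncomputable def r' (m : ℤ) : ArithmeticFunction ℝ := (oddz.pmul muR) * ((chi m).pmul muR)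

lemma pmul_conv (f g h : ArithmeticFunction ℝ) (hf : ∀ a b, f (a * b) = f a * f b) :
    f.pmul (g * h) = f.pmul g * f.pmul h := by
  ext n
  rw [ArithmeticFunction.pmul_apply, ArithmeticFunction.mul_apply, ArithmeticFunction.mul_apply,
    mul_sum]
  refine sum_congr rfl fun x hx => ?_
  obtain ⟨h, -⟩ := Nat.mem_divisorsAntidiagonal.mp hx
  simp only [ArithmeticFunction.pmul_apply]
  rw [← h, hf]; ring

lemma pmul_inv (f : ArithmeticFunction ℝ) (hf : ∀ a b, f (a * b) = f a * f b) (h1 : f 1 = 1) :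
    f * f.pmul muR = 1 := by
  have h : f = f.pmul ((ArithmeticFunction.zeta : ArithmeticFunction ℕ) : ArithmeticFunction ℝ) := by
    ext n
    rcases eq_or_ne n 0 with rfl | hn <;> simp [*]
  conv_lhs => rw [h]
  have h2 : f.pmul ((ArithmeticFunction.zeta : ArithmeticFunction ℕ) : ArithmeticFunction ℝ) = f := h.symm
  rw [show (f.pmul ((ArithmeticFunction.zeta : ArithmeticFunction ℕ) : ArithmeticFunction ℝ)).pmul muR
    = f.pmul muR by rw [h2], ← pmul_conv f _ _ hf, muR, ArithmeticFunction.coe_zeta_mul_coe_moebius]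
  ext n
  rw [ArithmeticFunction.pmul_apply]
  rcases eq_or_ne n 1 with rfl | hn
  · simp [h1]
  · simp [ArithmeticFunction.one_apply_ne hn]

lemma r_mul_r' (m : ℤ) : r m * r' m = 1 := by
  rw [r, r', mul_mul_mul_comm, pmul_inv oddz oddz_mul oddz_one,
    pmul_inv (chi m) (chi_mul m) (chi_one m), one_mul]

lemma isMult_of (f : ArithmeticFunction ℝ) (hf : ∀ a b, f (a * b) = f a * f b) (h1 : f 1 = 1) :
    f.IsMultiplicative := ⟨h1, fun _ => hf _ _⟩

lemma muR_mult : muR.IsMultiplicative := ArithmeticFunction.isMultiplicative_moebius.intCast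

lemma r_mult (m : ℤ) : (r m).IsMultiplicative :=
  (isMult_of _ oddz_mul oddz_one).mul (isMult_of _ (chi_mul m) (chi_one m))

lemma r'_mult (m : ℤ) : (r' m).IsMultiplicative :=
  ((isMult_of _ oddz_mul oddz_one).pmul muR_mult).mul
    ((isMult_of _ (chi_mul m) (chi_one m)).pmul muR_mult)

lemma le_of_prime_pow (f g : ArithmeticFunction ℝ) (hf : f.IsMultiplicative) (hg : g.IsMultiplicative)
    (h : ∀ p k, p.Prime → |f (p ^ k)| ≤ g (p ^ k)) (n : ℕ) : |f n| ≤ g n := by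
  rcases eq_or_ne n 0 with rfl | hn
  · simp
  rw [hf.multiplicative_factorization f hn, hg.multiplicative_factorization g hn, Finsupp.prod,
    Finsupp.prod, Finset.abs_prod]
  apply Finset.prod_le_prod
  · intros; positivity
  · intro p hp
    exact h p _ (Nat.prime_of_mem_primeFactors hp)

lemma conv_prime_pow (f g : ArithmeticFunction ℝ) (p k : ℕ) (hp : p.Prime) :
    (f * g) (p ^ k) = ∑ i ∈ range (k + 1), f (p ^ i) * g (p ^ (k - i)) := by
  rw [ArithmeticFunction.mul_apply, Nat.sum_divisorsAntidiagonal (fun a b => f a * g b),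
    Nat.sum_divisors_prime_pow hp]
  refine sum_congr rfl fun i hi => ?_
  rw [Nat.pow_div (by simp at hi; omega) hp.pos]

lemma cm_pow (f : ArithmeticFunction ℝ) (hf : ∀ a b, f (a * b) = f a * f b) (h1 : f 1 = 1) (p k : ℕ) :
    f (p ^ k) = f p ^ k := by
  induction k with
  | zero => simp [h1]
  | succ k ih => rw [pow_succ, hf, ih, pow_succ]

lemma r_prime_pow (m : ℤ) (p k : ℕ) (hp : p.Prime) :
    r m (p ^ k) = ∑ i ∈ range (k + 1), oddz p ^ i * chi m p ^ (k - i) := by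
  rw [r, conv_prime_pow _ _ _ _ hp]
  simp only [cm_pow _ oddz_mul oddz_one, cm_pow _ (chi_mul m) (chi_one m)]

lemma r_odd_prime_pow (m : ℤ) (p k : ℕ) (hp : p.Prime) (ho : Odd p) :
    r m (p ^ k) = ∑ i ∈ range (k + 1), chi m p ^ i := by
  rw [r_prime_pow m p k hp, oddz_apply, if_pos ho]
  simp only [one_pow, one_mul]
  rw [← Finset.sum_range_reflect]
  refine sum_congr rfl fun i hi => ?_
  congr 1
  simp at hi
  omega

lemma r_two_pow (m : ℤ) (k : ℕ) : r m (2 ^ k) = if k = 0 then 1 else 0 := by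
  rw [r_prime_pow m 2 k Nat.prime_two, oddz_apply, chi_apply, if_neg (by decide), if_neg (by decide)]
  split_ifs with h
  · subst h; simp
  · refine Finset.sum_eq_zero fun i hi => ?_
    rcases Nat.eq_zero_or_pos i with rfl | hi0
    · simp [h]
    · simp [hi0.ne']

lemma r_prime_pow_nonneg (m : ℤ) (p k : ℕ) (hp : p.Prime) : 0 ≤ r m (p ^ k) := by
  rcases hp.eq_two_or_odd' with rfl | ho
  · rw [r_two_pow]; split_ifs <;> norm_num
  · rw [r_odd_prime_pow m p k hp ho]
    rcases chi_vals m p with h | h | h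
    · rw [h]; positivity
    · rw [h]; positivity
    · rw [h, neg_one_geom_sum]; split_ifs <;> norm_num

lemma muR_prime_pow (p k : ℕ) (hp : p.Prime) (hk : 2 ≤ k) : muR (p ^ k) = 0 := by
  rw [muR, ArithmeticFunction.intCoe_apply, ArithmeticFunction.moebius_apply_prime_pow hp (by omega),
    if_neg (by omega)]
  simp

lemma muR_prime (p : ℕ) (hp : p.Prime) : muR p = -1 := by
  rw [muR, ArithmeticFunction.intCoe_apply, ArithmeticFunction.moebius_apply_prime hp]
  simp

lemma abs_r'_le (m : ℤ) (n : ℕ) : |r' m n| ≤ r m n := by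
  refine le_of_prime_pow _ _ (r'_mult m) (r_mult m) (fun p k hp => ?_) n
  have hm1 : muR 1 = 1 := muR_mult.1
  by_cases hk : 3 ≤ k
  · have : r' m (p ^ k) = 0 := by
      rw [r', conv_prime_pow _ _ _ _ hp]
      refine Finset.sum_eq_zero fun i hi => ?_
      simp only [ArithmeticFunction.pmul_apply]
      rcases le_or_gt 2 i with h | h
      · rw [muR_prime_pow p i hp h]; ring
      · rw [muR_prime_pow p (k - i) hp (by omega)]; ring
    rw [this, abs_zero]
    exact r_prime_pow_nonneg m p k hp
  · have hr' : r' m (p ^ k) = ∑ i ∈ range (k + 1),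
        (oddz p ^ i * muR (p ^ i)) * (chi m p ^ (k - i) * muR (p ^ (k - i))) := by
      rw [r', conv_prime_pow _ _ _ _ hp]
      simp only [ArithmeticFunction.pmul_apply, cm_pow _ oddz_mul oddz_one,
        cm_pow _ (chi_mul m) (chi_one m)]
    rw [hr', r_prime_pow m p k hp]
    have h2 := muR_prime_pow p 2 hp le_rfl
    have h1 := muR_prime p hp
    have hoc : (oddz p = 1 ∨ (oddz p = 0 ∧ chi m p = 0)) := by
      rw [oddz_apply, chi_apply]
      by_cases h : Odd p <;> simp [h]
    have hc := chi_vals m p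
    interval_cases k
    · simp [hm1]
    · simp [Finset.sum_range_succ, hm1, h1]
      rcases hoc with ho | ⟨ho, hc0⟩
      · rcases hc with hc | hc | hc <;> rw [ho, hc] <;> norm_num
      · rw [ho, hc0]; norm_num
    · simp [Finset.sum_range_succ, hm1, h1, h2]
      rcases hoc with ho | ⟨ho, hc0⟩
      · rcases hc with hc | hc | hc <;> rw [ho, hc] <;> norm_num
      · rw [ho, hc0]; norm_num

lemma r_nonneg (m : ℤ) (n : ℕ) : 0 ≤ r m n := (abs_nonneg _).trans (abs_r'_le m n)

/-- Indicator of nonzero squares. -/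
noncomputable def sq : ArithmeticFunction ℝ := by
  classical
  exact ⟨fun n => if IsSquare n ∧ n ≠ 0 then 1 else 0, by simp⟩

lemma sq_apply (n : ℕ) [Decidable (IsSquare n ∧ n ≠ 0)] : sq n = if IsSquare n ∧ n ≠ 0 then 1 else 0 := by
  simp only [sq, ArithmeticFunction.coe_mk]
  congr

lemma sq_mult : sq.IsMultiplicative := by
  classical
  refine ⟨by rw [sq_apply]; simp, fun {a b} hab => ?_⟩
  have : IsSquare (a * b) ∧ a * b ≠ 0 ↔ (IsSquare a ∧ a ≠ 0) ∧ (IsSquare b ∧ b ≠ 0) := by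
    constructor
    · rintro ⟨⟨c, hc⟩, h0⟩
      have ha0 := left_ne_zero_of_mul h0
      have hb0 := right_ne_zero_of_mul h0
      rw [← pow_two] at hc
      refine ⟨⟨?_, ha0⟩, ?_, hb0⟩
      · obtain ⟨d, hd⟩ := exists_associated_pow_of_mul_eq_pow (Nat.isUnit_iff.2 hab) hc
        rw [associated_iff_eq] at hd
        exact ⟨d, by rw [← hd, pow_two]⟩
      · rw [mul_comm] at hc
        obtain ⟨d, hd⟩ := exists_associated_pow_of_mul_eq_pow (Nat.isUnit_iff.2 hab.symm) hc
        rw [associated_iff_eq] at hd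
        exact ⟨d, by rw [← hd, pow_two]⟩
    · rintro ⟨⟨ha, ha0⟩, hb, hb0⟩
      exact ⟨ha.mul hb, mul_ne_zero ha0 hb0⟩
  rw [sq_apply, sq_apply, sq_apply]
  simp only [this]
  by_cases h1 : IsSquare a ∧ a ≠ 0 <;> by_cases h2 : IsSquare b ∧ b ≠ 0 <;> simp [h1, h2]

lemma sq_nonneg' (n : ℕ) : 0 ≤ sq n := by
  classical
  rw [sq_apply]; split_ifs <;> norm_num

/-- Number of square roots of m modulo odd n. -/
noncomputable def rho (m : ℤ) : ArithmeticFunction ℝ :=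
  ⟨fun n => if Odd n then (Nat.card {b : ZMod n // b ^ 2 = (m : ZMod n)} : ℝ) else 0, by simp⟩

lemma rho_apply (m : ℤ) (n : ℕ) :
    rho m n = if Odd n then (Nat.card {b : ZMod n // b ^ 2 = (m : ZMod n)} : ℝ) else 0 := rfl

lemma rho_nonneg (m : ℤ) (n : ℕ) : 0 ≤ rho m n := by
  rw [rho_apply]; split_ifs <;> positivity

lemma rho_mult (m : ℤ) : (rho m).IsMultiplicative := by
  constructor
  · rw [rho_apply, if_pos odd_one]
    have : Nat.card {b : ZMod 1 // b ^ 2 = (m : ZMod 1)} = 1 := by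
      rw [Nat.card_eq_one_iff_unique]
      exact ⟨⟨fun a b => Subtype.ext (Subsingleton.elim _ _)⟩, ⟨0, Subsingleton.elim _ _⟩⟩
    rw [this]; simp
  · intro a b hab
    simp only [rho_apply, Nat.odd_mul]
    by_cases ha : Odd a <;> by_cases hb : Odd b <;> simp only [ha, hb, and_self, and_true, and_false, if_true, if_false, mul_zero, zero_mul]
    rw [← Nat.cast_mul, ← Nat.card_prod]
    congr 1
    let e := ZMod.chineseRemainder hab
    refine Nat.card_congr ((e.toEquiv.subtypeEquiv (q := fun x : ZMod a × ZMod b =>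
      x.1 ^ 2 = (m : ZMod a) ∧ x.2 ^ 2 = (m : ZMod b)) ?_).trans
      (Equiv.subtypeProdEquivProd (p := fun x : ZMod a => x ^ 2 = (m : ZMod a)) (q := fun x : ZMod b => x ^ 2 = (m : ZMod b))))
    intro x
    have : x ^ 2 = (m : ZMod (a * b)) ↔ e x ^ 2 = (m : ZMod a × ZMod b) := by
      rw [← map_pow, ← map_intCast e, e.injective.eq_iff]
    rw [this, Prod.ext_iff]
    simp

lemma hensel (m : ℤ) (p : ℕ) (hp : p.Prime) (ho : Odd p) (b₀ : ℤ) (h0 : (p : ℤ) ∣ b₀ ^ 2 - m)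
    (h1 : ¬ (p : ℤ) ∣ b₀) (j : ℕ) : ∃ b : ℤ, (p : ℤ) ^ (j + 1) ∣ b ^ 2 - m ∧ ¬ (p : ℤ) ∣ b := by
  induction j with
  | zero => exact ⟨b₀, by simpa using h0, h1⟩
  | succ j ih =>
    obtain ⟨b, ⟨c, hc⟩, hb⟩ := ih
    have hp' : Prime (p : ℤ) := Nat.prime_iff_prime_int.1 hp
    have h2b : ¬ (p : ℤ) ∣ 2 * b := by
      intro h
      rcases hp'.dvd_or_dvd h with h | h
      · have h' : p ∣ 2 := by exact_mod_cast h
        rw [Nat.prime_dvd_prime_iff_eq hp Nat.prime_two] at h'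
        subst h'
        exact absurd ho (by decide)
      · exact hb h
    obtain ⟨u, v, huv⟩ := (Prime.coprime_iff_not_dvd hp').2 h2b
    -- u * p + v * (2 b) = 1
    refine ⟨b - c * v * p ^ (j + 1), ?_, ?_⟩
    · refine ⟨c * u + c ^ 2 * v ^ 2 * p ^ j, ?_⟩
      have : (b - c * v * p ^ (j + 1)) ^ 2 - m = (p : ℤ) ^ (j + 1) * c - p ^ (j+1) * (c * (v * (2 * b)))
        + c ^ 2 * v ^ 2 * (p ^ (j + 1)) ^ 2 := by linear_combination hc
      rw [this, show v * (2 * b) = 1 - u * p by linear_combination huv]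
      ring
    · intro h
      apply hb
      have : b = (b - c * v * p ^ (j + 1)) + p * (c * v * p ^ j) := by ring
      rw [this]
      exact dvd_add h (dvd_mul_right _ _)

lemma two_le_rho (m : ℤ) (p j : ℕ) (hp : p.Prime) (ho : Odd p) (hc : chi m p = 1) :
    2 ≤ rho m (p ^ (j + 1)) := by
  have hfp : Fact p.Prime := ⟨hp⟩
  rw [chi_apply, if_pos ho, ← jacobiSym.legendreSym.to_jacobiSym] at hc
  have hc' : legendreSym p m = 1 := by exact_mod_cast hc
  have hm0 : (m : ZMod p) ≠ 0 := by
    intro h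
    rw [(legendreSym.eq_zero_iff p m).2 h] at hc'
    norm_num at hc'
  obtain ⟨x, hx⟩ := (legendreSym.eq_one_iff p hm0).1 hc'
  obtain ⟨b₀, rfl⟩ := ZMod.intCast_surjective x
  have h0 : (p : ℤ) ∣ b₀ ^ 2 - m := by
    rw [← ZMod.intCast_zmod_eq_zero_iff_dvd]; push_cast; rw [hx]; ring
  have h1 : ¬ (p : ℤ) ∣ b₀ := by
    intro h
    rw [← ZMod.intCast_zmod_eq_zero_iff_dvd] at h
    rw [h] at hx
    exact hm0 (by simpa using hx)
  obtain ⟨b, hb, hbp⟩ := hensel m p hp ho b₀ h0 h1 j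
  have hne : NeZero (p ^ (j + 1)) := ⟨(pow_pos hp.pos _).ne'⟩
  have hb' : ((b : ZMod (p ^ (j+1)))) ^ 2 = (m : ZMod (p ^ (j+1))) := by
    have : ((b ^ 2 - m : ℤ) : ZMod (p ^ (j + 1))) = 0 := by
      rw [ZMod.intCast_zmod_eq_zero_iff_dvd]; exact_mod_cast hb
    push_cast at this
    linear_combination this
  rw [rho_apply, if_pos ho.pow]
  have : 1 < Nat.card {b : ZMod (p ^ (j+1)) // b ^ 2 = (m : ZMod (p ^ (j+1)))} := by
    rw [Finite.one_lt_card_iff_nontrivial]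
    refine ⟨⟨(b : ZMod _), hb'⟩, ⟨-(b : ZMod _), by rw [neg_sq, hb']⟩, ?_⟩
    intro h
    have h := congrArg Subtype.val h
    simp only at h
    have h2 : ((2 * b : ℤ) : ZMod (p ^ (j + 1))) = 0 := by
      push_cast; linear_combination h
    rw [ZMod.intCast_zmod_eq_zero_iff_dvd] at h2
    have h3 : (p : ℤ) ∣ 2 * b := by
      refine dvd_trans ?_ h2
      push_cast
      exact dvd_pow_self _ (by omega)
    rcases (Nat.prime_iff_prime_int.1 hp).dvd_or_dvd h3 with h | h
    · have h' : p ∣ 2 := by exact_mod_cast h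
      rw [Nat.prime_dvd_prime_iff_eq hp Nat.prime_two] at h'
      subst h'
      exact absurd ho (by decide)
    · exact hbp h
  exact_mod_cast this

lemma one_le_rho (m : ℤ) (p : ℕ) (hp : p.Prime) (ho : Odd p) (hc : chi m p = 0) :
    1 ≤ rho m p := by
  have hfp : Fact p.Prime := ⟨hp⟩
  rw [chi_apply, if_pos ho, ← jacobiSym.legendreSym.to_jacobiSym] at hc
  have hc' : legendreSym p m = 0 := by exact_mod_cast hc
  have hm0 := (legendreSym.eq_zero_iff p m).1 hc'
  rw [rho_apply, if_pos ho]
  have : 0 < Nat.card {b : ZMod p // b ^ 2 = (m : ZMod p)} :=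
    Nat.card_pos_iff.2 ⟨⟨⟨0, by rw [hm0]; simp⟩⟩, inferInstance⟩
  exact_mod_cast this

lemma sqrho_nonneg (m : ℤ) (n : ℕ) : 0 ≤ (sq * rho m) n := by
  rw [ArithmeticFunction.mul_apply]
  exact sum_nonneg fun x _ => mul_nonneg (sq_nonneg' _) (rho_nonneg _ _)

lemma sqrho_step (m : ℤ) (p k : ℕ) (hp : p.Prime) :
    (sq * rho m) (p ^ k) + rho m (p ^ (k + 2)) ≤ (sq * rho m) (p ^ (k + 2)) := by
  classical
  rw [conv_prime_pow _ _ _ k hp, conv_prime_pow _ _ _ (k + 2) hp, Finset.sum_range_succ' _ (k + 2),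
    Finset.sum_range_succ' _ (k + 1)]
  have h1 : sq (p ^ 0) = 1 := by simpa using sq_mult.1
  rw [h1]
  have h2 : 0 ≤ sq (p ^ (0 + 1)) * rho m (p ^ (k + 2 - (0 + 1))) :=
    mul_nonneg (sq_nonneg' _) (rho_nonneg _ _)
  have h3 : ∑ i ∈ range (k + 1), sq (p ^ i) * rho m (p ^ (k - i)) ≤
      ∑ i ∈ range (k + 1), sq (p ^ (i + 1 + 1)) * rho m (p ^ (k + 2 - (i + 1 + 1))) := by
    refine sum_le_sum fun i _ => ?_
    rw [show k + 2 - (i + 1 + 1) = k - i by omega]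
    refine mul_le_mul_of_nonneg_right ?_ (rho_nonneg _ _)
    rw [sq_apply, sq_apply]
    split_ifs with ha hb
    · exact le_rfl
    · exfalso
      apply hb
      refine ⟨?_, (pow_pos hp.pos _).ne'⟩
      obtain ⟨c, hc⟩ := ha.1
      exact ⟨c * p, by rw [pow_succ, pow_succ, hc]; ring⟩
    · norm_num
    · exact le_rfl
  simp only [Nat.sub_zero, one_mul]
  linarith

lemma r_le_sqrho (m : ℤ) (n : ℕ) : r m n ≤ (sq * rho m) n := by
  refine (le_abs_self _).trans (le_of_prime_pow _ _ (r_mult m) (sq_mult.mul (rho_mult m)) (fun p k hp => ?_) n)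
  rw [abs_of_nonneg (r_prime_pow_nonneg m p k hp)]
  rcases hp.eq_two_or_odd' with rfl | ho
  · rw [r_two_pow]
    split_ifs with h
    · subst h
      rw [pow_zero, (sq_mult.mul (rho_mult m)).1]
    · exact sqrho_nonneg _ _
  · rw [r_odd_prime_pow m p k hp ho]
    induction k using Nat.twoStepInduction with
    | zero => simp [(sq_mult.mul (rho_mult m)).1]
    | one =>
      rw [conv_prime_pow _ _ _ _ hp]
      have h1 : sq 1 = 1 := sq_mult.1
      have h2 : rho m 1 = 1 := (rho_mult m).1
      have h3 := sq_nonneg' p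
      simp [Finset.sum_range_succ, h1, h2]
      rcases chi_vals m p with h | h | h
      · have := one_le_rho m p hp ho h
        linarith
      · have := two_le_rho m p 0 hp ho h
        simp at this
        linarith
      · have := rho_nonneg m p
        linarith
    | more k ih _ =>
      refine le_trans ?_ (sqrho_step m p k hp)
      rw [Finset.sum_range_succ, Finset.sum_range_succ, add_assoc]
      refine add_le_add ih ?_
      rcases chi_vals m p with h | h | h
      · rw [h]; simpa using rho_nonneg m _
      · have := two_le_rho m p (k + 1) hp ho h
        rw [h]
        simp only [one_pow]
        linarith
      · rw [h, pow_succ _ (k+1)]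
        have := rho_nonneg m (p ^ (k + 2))
        linarith

end HB
open Finset Filter Topology

namespace HB

lemma bezout3 (n b c m : ℤ) (hn : Odd n) (hm : Squarefree m) (h : n * c = b ^ 2 - m) :
    ∃ p q t : ℤ, p * n + q * (2 * b) + t * c = 1 := by
  have h1 : IsCoprime n (Int.gcd (2 * b) c : ℤ) := by
    apply isCoprime_of_prime_dvd
    · rintro ⟨rfl, -⟩
      simp at hn
    · intro p hp h1 h2
      have h3 : p ∣ 2 * b := h2.trans (Int.gcd_dvd_left ..)
      have h4 : p ∣ c := h2.trans (Int.gcd_dvd_right ..)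
      have h5 : p ∣ b := by
        rcases hp.dvd_or_dvd h3 with h' | h'
        · exfalso
          obtain ⟨k, rfl⟩ := hn
          have : p ∣ 1 := by
            have := dvd_sub h1 (h'.mul_right k)
            simpa using this
          exact hp.not_isUnit (isUnit_of_dvd_one this)
        · exact h'
      have : p * p ∣ m := by
        have e : m = b * b - n * c := by linarith
        rw [e]
        exact dvd_sub (mul_dvd_mul h5 h5) (mul_dvd_mul h1 h4)
      exact hp.not_isUnit (hm p this)
  obtain ⟨p, q, e⟩ := h1
  rw [Int.gcd_eq_gcd_ab] at e
  exact ⟨p, q * Int.gcdA (2 * b) c, q * Int.gcdB (2 * b) c, by linarith⟩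

section
variable {O : Type*} [CommRing O]

lemma coord_unique (ι : O →+* ℂ) (s : O) (D : ℝ) (hD : 0 < D)
    (hs : ι s = Complex.I * (Real.sqrt D : ℝ)) (u v u' v' : ℤ)
    (h : (u : O) + v * s = u' + v' * s) : u = u' ∧ v = v' := by
  have h := congrArg ι h
  simp only [map_add, map_mul, map_intCast, hs] at h
  have h1 := congrArg Complex.re h
  have h2 := congrArg Complex.im h
  simp at h1 h2
  refine ⟨by exact_mod_cast h1, ?_⟩
  have : Real.sqrt D ≠ 0 := (Real.sqrt_pos.mpr hD).ne'
  rcases h2 with h2 | h2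
  · exact_mod_cast h2
  · exact absurd h2 this

/-- The ideal attached to a residue. -/
def idl (s : O) (n b : ℕ) : Ideal O := Ideal.span {(n : O), (b : O) - s}

lemma idl_coord (s : O) (m : ℤ) (hsm : s ^ 2 = (m : O)) (hO : ∀ x : O, ∃ u v : ℤ, 2 * x = u + v * s)
    (n b : ℕ) (hb : (n : ℤ) ∣ (b : ℤ) ^ 2 - m) (a : O) (ha : a ∈ idl s n b) :
    ∃ u v : ℤ, 2 * a = u + v * s ∧ (n : ℤ) ∣ u + v * b := by
  rw [idl, Ideal.mem_span_pair] at ha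
  obtain ⟨p, q, rfl⟩ := ha
  obtain ⟨u1, v1, h1⟩ := hO p
  obtain ⟨u2, v2, h2⟩ := hO q
  obtain ⟨c, hc⟩ := hb
  refine ⟨n * u1 + u2 * b - v2 * m, n * v1 - u2 + v2 * b, ?_, u1 + v1 * b + v2 * c, ?_⟩
  · push_cast
    linear_combination (n : O) * h1 + ((b : O) - s) * h2 - (v2 : O) * hsm
  · linear_combination v2 * hc

/-- Conjugation exists. -/
lemma exists_conj (ι : O →+* ℂ) (hι : Function.Injective ι) (s : O) (D : ℝ)
    (hs : ι s = Complex.I * (Real.sqrt D : ℝ)) (hO : ∀ x : O, ∃ u v : ℤ, 2 * x = u + v * s) :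
    ∃ σ : O →+* O, ∀ x, ι (σ x) = starRingEnd ℂ (ι x) := by
  have h : ∀ x : O, ∃ y : O, ι y = starRingEnd ℂ (ι x) := by
    intro x
    obtain ⟨u, v, h⟩ := hO x
    refine ⟨u - x, ?_⟩
    have h := congrArg ι h
    simp only [map_add, map_mul, map_intCast, hs, map_ofNat] at h
    have h' := congrArg (starRingEnd ℂ) h
    simp only [map_add, map_mul, map_intCast, map_ofNat, Complex.conj_I, Complex.conj_ofReal] at h'
    rw [map_sub, map_intCast]
    linear_combination -h / 2 - h' / 2
  choose f hf using h
  refine ⟨⟨⟨⟨f, ?_⟩, ?_⟩, ?_, ?_⟩, hf⟩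
  · apply hι; simp [hf]
  · intro x y; apply hι; simp [hf]
  · apply hι; simp [hf]
  · intro x y; apply hι; simp [hf]

lemma idl_mul_conj (ι : O →+* ℂ) (hι : Function.Injective ι) (s : O) (D : ℝ)
    (hs : ι s = Complex.I * (Real.sqrt D : ℝ)) (m : ℤ) (hm : Squarefree m) (hsm : s ^ 2 = (m : O))
    (σ : O →+* O) (hσ : ∀ x, ι (σ x) = starRingEnd ℂ (ι x))
    (n b : ℕ) (hn : Odd n) (hb : (n : ℤ) ∣ (b : ℤ) ^ 2 - m) :
    idl s n b * (idl s n b).map σ = Ideal.span {(n : O)} := by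
  have hσs : σ s = - s := by
    apply hι
    rw [hσ, hs, map_neg, hs]
    simp
  obtain ⟨c, hc⟩ := hb
  have hcO : (n : O) * c = b ^ 2 - m := by exact_mod_cast congrArg (Int.cast : ℤ → O) hc.symm
  have hmap : (idl s n b).map σ = Ideal.span {(n : O), (b : O) + s} := by
    rw [idl, Ideal.map_span, Set.image_pair]
    simp [hσs]
  rw [hmap, idl, Ideal.span_pair_mul_span_pair]
  apply le_antisymm
  · rw [Ideal.span_le]
    rintro y (rfl | rfl | rfl | rfl) <;> rw [SetLike.mem_coe, Ideal.mem_span_singleton]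
    · exact dvd_mul_right _ _
    · exact dvd_mul_right _ _
    · exact dvd_mul_left _ _
    · exact ⟨c, by linear_combination -hsm - hcO⟩
  · rw [Ideal.span_singleton_le_iff_mem]
    obtain ⟨p, q, t, e⟩ := bezout3 n b c m (by exact_mod_cast hn) hm hc.symm
    have eO : (p : O) * n + q * (2 * b) + t * c = 1 := by exact_mod_cast congrArg (Int.cast : ℤ → O) e
    have : (n : O) = p * (n * n) + q * (n * (b + s)) + q * ((b - s) * n) + t * ((b - s) * (b + s)) := by
      linear_combination (-(n : O)) * eO + (t : O) * hsm + t * hcO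
    have hmem : ∀ z ∈ ({(n : O) * n, n * (b + s), (b - s) * n, (b - s) * (b + s)} : Set O),
      z ∈ Ideal.span ({(n : O) * n, n * (b + s), (b - s) * n, (b - s) * (b + s)} : Set O) :=
        fun z hz => Ideal.subset_span hz
    have key : p * (n * n) + q * (n * (b + s)) + q * ((b - s) * n) + t * ((b - s) * (b + s)) ∈
      Ideal.span ({(n : O) * n, n * (b + s), (b - s) * n, (b - s) * (b + s)} : Set O) := by
      refine add_mem (add_mem (add_mem ?_ ?_) ?_) ?_ <;> refine Ideal.mul_mem_left _ _ (hmem _ ?_) <;> simp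
    rw [← this] at key
    exact key

lemma unit_one [IsDomain O] (ι : O →+* ℂ) (s : O) (D : ℝ) (hD : 0 < D)
    (hs : ι s = Complex.I * (Real.sqrt D : ℝ)) (hO : ∀ x : O, ∃ u v : ℤ, 2 * x = u + v * s)
    (h2 : ¬ IsUnit (2 : O)) (e f : O) (hef : e * f = 1) (t : ℝ) (ht : 0 < t) (he : ι e = t) : e = 1 := by
  have key : ∀ (e : O) (t : ℝ), 0 < t → ι e = t → ∃ u : ℤ, 0 < u ∧ 2 * e = u := by
    intro e t ht he
    obtain ⟨u, v, h⟩ := hO e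
    have h' := congrArg ι h
    simp only [map_add, map_mul, map_intCast, hs, map_ofNat, he] at h'
    have h1 := congrArg Complex.re h'
    have h3 := congrArg Complex.im h'
    simp at h1 h3
    have hv : v = 0 := by
      rcases h3 with h3 | h3
      · exact_mod_cast h3
      · exact absurd h3 (Real.sqrt_pos.mpr hD).ne'
    refine ⟨u, ?_, by rw [h, hv]; simp⟩
    have : (0:ℝ) < u := by linarith
    exact_mod_cast this
  have hf : ι f = (t⁻¹ : ℝ) := by
    have := congrArg ι hef
    rw [map_mul, he, map_one] at this
    rw [Complex.ofReal_inv]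
    exact eq_inv_of_mul_eq_one_right this
  obtain ⟨u, hu, h1⟩ := key e t ht he
  obtain ⟨v, hv, h3⟩ := key f _ (by positivity) hf
  have h4 : u * v = 4 := by
    have : (ι (u * v : O)) = ι 4 := by
      congr 1
      rw [← h1, ← h3]; linear_combination 4 * hef
    rw [map_mul, map_intCast, map_intCast, map_ofNat] at this
    exact_mod_cast this
  have hu1 : u ≠ 1 := by
    rintro rfl
    exact h2 (IsUnit.of_mul_eq_one e (by simpa using h1))
  have hv1 : v ≠ 1 := by
    rintro rfl
    exact h2 (IsUnit.of_mul_eq_one f (by simpa using h3))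
  have hu2 : u = 2 := by
    have : u ≤ 2 := by nlinarith [show 2 ≤ v by omega]
    omega
  have h20 : (2 : O) ≠ 0 := by
    intro h
    have := congrArg ι h
    rw [map_ofNat, map_zero] at this
    norm_num at this
  apply mul_left_cancel₀ h20
  rw [h1, hu2]; simp

lemma same_class [IsDomain O] (ι : O →+* ℂ) (hι : Function.Injective ι) (s : O) (D : ℝ) (hD : 0 < D)
    (hs : ι s = Complex.I * (Real.sqrt D : ℝ)) (m : ℤ) (hm : Squarefree m) (hsm : s ^ 2 = (m : O))
    (hO : ∀ x : O, ∃ u v : ℤ, 2 * x = u + v * s) (h2 : ¬ IsUnit (2 : O))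
    (σ : O →+* O) (hσ : ∀ x, ι (σ x) = starRingEnd ℂ (ι x))
    (n b : ℕ) (hn : Odd n) (hb : (n : ℤ) ∣ (b : ℤ) ^ 2 - m)
    (n' b' : ℕ) (hn' : Odd n') (hb' : (n' : ℤ) ∣ (b' : ℤ) ^ 2 - m)
    (x y : O) (hx : x ≠ 0) (hy : y ≠ 0)
    (h : Ideal.span {x} * idl s n b = Ideal.span {y} * idl s n' b') :
    ∃ z ∈ idl s n' b', x * n = y * z ∧ z * σ z = n * n' := by
  have hxn : x * n ∈ Ideal.span {y} * idl s n' b' := by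
    rw [← h]
    exact Ideal.mul_mem_mul (Ideal.mem_span_singleton_self x) (Ideal.subset_span (by simp))
  rw [Ideal.mem_span_singleton_mul] at hxn
  obtain ⟨z, hz, hz'⟩ := hxn
  refine ⟨z, hz, hz'.symm, ?_⟩
  have hσh := congrArg (Ideal.map σ) h
  rw [Ideal.map_mul, Ideal.map_mul, Ideal.map_span, Ideal.map_span, Set.image_singleton,
    Set.image_singleton] at hσh
  have e1 : Ideal.span {x * σ x * n} = Ideal.span {y * σ y * n'} := by
    simp only [← Ideal.span_singleton_mul_span_singleton]
    rw [← idl_mul_conj ι hι s D hs m hm hsm σ hσ n b hn hb,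
      ← idl_mul_conj ι hι s D hs m hm hsm σ hσ n' b' hn' hb', mul_mul_mul_comm, h, hσh,
      mul_mul_mul_comm]
  rw [Ideal.span_singleton_eq_span_singleton] at e1
  obtain ⟨e, he⟩ := e1
  have hpos : ∀ w : O, w ≠ 0 → ∃ t : ℝ, 0 < t ∧ ι (w * σ w) = t := by
    intro w hw
    refine ⟨Complex.normSq (ι w), Complex.normSq_pos.mpr ?_, ?_⟩
    · rwa [Ne, map_eq_zero_iff ι hι]
    · rw [map_mul, hσ, Complex.mul_conj]
  obtain ⟨t1, ht1, e1⟩ := hpos x hx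
  obtain ⟨t2, ht2, e2⟩ := hpos y hy
  have hn0 : (0:ℝ) < n := by exact_mod_cast hn.pos
  have hn0' : (0:ℝ) < n' := by exact_mod_cast hn'.pos
  have he1 : (e : O) = 1 := by
    refine unit_one ι s D hD hs hO h2 e ((e⁻¹ : Oˣ) : O) (by simp) (t2 * n' / (t1 * n)) (by positivity) ?_
    have := congrArg ι he
    rw [map_mul, map_mul, e1, map_mul ι (y * σ y), e2] at this
    simp only [map_natCast] at this
    push_cast
    rw [eq_div_iff]
    · linear_combination this
    · have h1 : (t1 : ℂ) ≠ 0 := by exact_mod_cast ht1.ne'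
      have h2 : (n : ℂ) ≠ 0 := by exact_mod_cast hn0.ne'
      exact mul_ne_zero h1 h2
  rw [he1, mul_one] at he
  have hyy : y * σ y ≠ 0 := by
    intro h
    rw [h, map_zero] at e2
    exact ht2.ne (by exact_mod_cast e2)
  have hz2 := congrArg σ hz'
  rw [map_mul, map_mul, map_natCast] at hz2
  apply mul_left_cancel₀ hyy
  calc y * σ y * (z * σ z) = (y * z) * (σ y * σ z) := by ring
    _ = x * σ x * n * n := by rw [hz', hz2]; ring
    _ = _ := by rw [he]; ring

lemma same_elt [IsDedekindDomain O] (ι : O →+* ℂ) (s : O) (D : ℝ) (hD : 0 < D)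
    (hs : ι s = Complex.I * (Real.sqrt D : ℝ)) (m : ℤ) (hsm : s ^ 2 = (m : O))
    (hO : ∀ x : O, ∃ u v : ℤ, 2 * x = u + v * s)
    (J : Ideal O) (z : O) (n b b' : ℕ) (hn : Odd n)
    (hb' : (n : ℤ) ∣ (b' : ℤ) ^ 2 - m) (hbn : b < n) (hbn' : b' < n)
    (x y x' y' : O) (hx : x ≠ 0) (hy : y' ≠ 0)
    (h : Ideal.span {x} * idl s n b = Ideal.span {y} * J)
    (h' : Ideal.span {x'} * idl s n b' = Ideal.span {y'} * J)
    (hz : x * n = y * z) (hz' : x' * n = y' * z) : b = b' := by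
  have hn0 : (n : O) ≠ 0 := by
    intro h
    have := congrArg ι h
    rw [map_natCast, map_zero] at this
    exact hn.pos.ne' (by exact_mod_cast this)
  have e : x * y' = x' * y := by
    apply mul_right_cancel₀ hn0
    linear_combination y' * hz - y * hz'
  have hI : idl s n b = idl s n b' := by
    have : Ideal.span {x * y'} * idl s n b = Ideal.span {x * y'} * idl s n b' := by
      conv_rhs => rw [e]
      rw [← Ideal.span_singleton_mul_span_singleton, ← Ideal.span_singleton_mul_span_singleton,
        mul_right_comm, h, mul_right_comm (Ideal.span {x'}), h']
      ring
    refine mul_left_cancel₀ ?_ this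
    simp [hx, hy]
  have hmem : (b : O) - s ∈ idl s n b' := by
    rw [← hI]
    exact Ideal.subset_span (by simp)
  obtain ⟨u, v, h1, h2⟩ := idl_coord s m hsm hO n b' hb' _ hmem
  obtain ⟨rfl, rfl⟩ := coord_unique ι s D hD hs u v (2 * b) (-2) (by rw [← h1]; push_cast; ring)
  have h3 : (n : ℤ) ∣ 2 * (b - b') := by convert h2 using 1; ring
  have h4 : (n : ℤ) ∣ b - b' := by
    refine IsCoprime.dvd_of_dvd_mul_left ?_ h3
    obtain ⟨k, rfl⟩ := hn
    exact ⟨1, -k, by push_cast; ring⟩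
  have := Int.eq_zero_of_abs_lt_dvd h4 (by rw [abs_lt]; omega)
  omega

end
end HB
open Finset Filter Topology

namespace HB

lemma count_uv (D : ℝ) (hD : 0 < D) (x n' : ℕ) (hn1 : 1 ≤ n') (hnx : n' ≤ x) (b' : ℤ)
    (F : Finset (ℤ × ℤ)) (h1 : ∀ p ∈ F, (p.1 : ℝ) ^ 2 + D * (p.2 : ℝ) ^ 2 ≤ 4 * x * n')
    (h2 : ∀ p ∈ F, (n' : ℤ) ∣ p.1 + p.2 * b') :
    (F.card : ℝ) ≤ 24 * (x / Real.sqrt D) + 6 * Real.sqrt x := by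
  have hn0 : (0:ℝ) < n' := by exact_mod_cast hn1
  have hx1 : (1:ℝ) ≤ x := by exact_mod_cast hn1.trans hnx
  have hnx' : (n' : ℝ) ≤ x := by exact_mod_cast hnx
  have hn1' : (1:ℝ) ≤ n' := by exact_mod_cast hn1
  have hsD : 0 < √D := Real.sqrt_pos.mpr hD
  have hsn : 1 ≤ √(n' : ℝ) := Real.one_le_sqrt.mpr hn1'
  have hsx : √(n' : ℝ) ≤ √x := Real.sqrt_le_sqrt hnx'
  have hD2 : √D ^ 2 = D := Real.sq_sqrt hD.le
  have hn2 : √(n' : ℝ) ^ 2 = n' := Real.sq_sqrt hn0.le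
  have hx2 : √(x : ℝ) ^ 2 = x := Real.sq_sqrt (by linarith)
  set V : ℝ := 2 * √(x : ℝ) * √(n' : ℝ) / √D with hV
  set W : ℝ := 2 * √(x : ℝ) / √(n' : ℝ) with hW
  have hV0 : 0 ≤ V := by positivity
  have hW0 : 0 ≤ W := by positivity
  have hVn : 0 ≤ ⌊V⌋ := Int.floor_nonneg.mpr hV0
  have hWn : 0 ≤ ⌊W⌋ := Int.floor_nonneg.mpr hW0
  have hcard : F.card ≤ (Icc (-⌊V⌋) ⌊V⌋ ×ˢ Icc (-⌊W⌋ - 1) ⌊W⌋).card := by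
    refine card_le_card_of_injOn (fun p => (p.2, p.1 / (n' : ℤ))) ?_ ?_
    · rintro ⟨u, v⟩ hp
      have hh := h1 _ hp
      simp only at hh
      have hv : |(v : ℝ)| ≤ V := by
        apply abs_le_of_sq_le_sq _ hV0
        rw [hV, div_pow, mul_pow, mul_pow, hx2, hn2, hD2, le_div_iff₀ hD]
        nlinarith [sq_nonneg (u : ℝ)]
      have hu : |(u : ℝ) / n'| ≤ W := by
        apply abs_le_of_sq_le_sq _ hW0
        rw [hW, div_pow, div_pow, mul_pow, hx2, hn2, div_le_div_iff₀ (by positivity) hn0]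
        have : 0 ≤ D * (v : ℝ) ^ 2 := by positivity
        have : (u : ℝ) ^ 2 ≤ 4 * x * n' := by linarith
        nlinarith
      rw [abs_le] at hv hu
      simp only [coe_product, Set.mem_prod, coe_Icc, Set.mem_Icc]
      have hf : u / (n' : ℤ) = ⌊(u : ℝ) / n'⌋ := by
        symm
        rw [Int.floor_eq_iff, le_div_iff₀ hn0, div_lt_iff₀ hn0]
        have hp : (0:ℤ) < n' := by exact_mod_cast hn1
        have q1 := Int.ediv_mul_le u hp.ne'
        have q2 := Int.lt_ediv_add_one_mul_self u hp
        exact ⟨by exact_mod_cast q1, by exact_mod_cast q2⟩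
      refine ⟨⟨?_, Int.le_floor.mpr hv.2⟩, ?_, ?_⟩
      · rw [neg_le]; exact Int.le_floor.mpr (by push_cast; linarith)
      · rw [hf]
        apply Int.le_floor.mpr
        push_cast
        have := Int.lt_floor_add_one W
        linarith
      · rw [hf]; exact Int.floor_le_floor hu.2
    · rintro ⟨u, v⟩ hp ⟨u', v'⟩ hp' h
      simp only [Prod.mk.injEq] at h ⊢
      obtain ⟨rfl, h⟩ := h
      have := dvd_sub (h2 _ hp) (h2 _ hp')
      simp only [add_sub_add_right_eq_sub] at this
      have h3 : u % (n' : ℤ) = u' % n' := 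
        Int.emod_eq_emod_iff_emod_sub_eq_zero.mpr (Int.emod_eq_zero_of_dvd this)
      refine ⟨?_, rfl⟩
      rw [← Int.mul_ediv_add_emod u n', ← Int.mul_ediv_add_emod u' n', h, h3]
  rw [card_product, Int.card_Icc, Int.card_Icc] at hcard
  have e1 : (((⌊V⌋ + 1 - -⌊V⌋).toNat : ℕ) : ℝ) ≤ 2 * V + 1 := by
    have : (((⌊V⌋ + 1 - -⌊V⌋).toNat : ℕ) : ℝ) = ((⌊V⌋ + 1 - -⌊V⌋ : ℤ) : ℝ) := by
      exact_mod_cast congrArg (Int.cast : ℤ → ℝ) (Int.toNat_of_nonneg (by omega))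
    rw [this]; push_cast
    linarith [Int.floor_le V]
  have e2 : (((⌊W⌋ + 1 - (-⌊W⌋ - 1)).toNat : ℕ) : ℝ) ≤ 2 * W + 2 := by
    have : (((⌊W⌋ + 1 - (-⌊W⌋ - 1)).toNat : ℕ) : ℝ) = ((⌊W⌋ + 1 - (-⌊W⌋ - 1) : ℤ) : ℝ) := by
      exact_mod_cast congrArg (Int.cast : ℤ → ℝ) (Int.toNat_of_nonneg (by omega))
    rw [this]; push_cast
    linarith [Int.floor_le W]
  have hc : (F.card : ℝ) ≤ (2 * V + 1) * (2 * W + 2) := by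
    calc (F.card : ℝ) ≤ ((((⌊V⌋ + 1 - -⌊V⌋).toNat * (⌊W⌋ + 1 - (-⌊W⌋ - 1)).toNat : ℕ)) : ℝ) := by
          exact_mod_cast hcard
      _ ≤ _ := by push_cast at e1 e2 ⊢; gcongr
  have e3 : V * W = 4 * (x / √D) := by
    rw [hV, hW]
    have : √(n' : ℝ) ≠ 0 := by positivity
    field_simp
    rw [hx2]; ring
  have e4 : V ≤ 2 * (x / √D) := by
    rw [hV, ← mul_div_assoc]
    have : √(x : ℝ) * √(n' : ℝ) ≤ x := by nlinarith
    refine div_le_div_of_nonneg_right ?_ hsD.le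
    linarith
  have e5 : W ≤ 2 * √(x : ℝ) := by
    rw [hW]
    exact div_le_self (by positivity) hsn
  have e6 : 1 ≤ √(x : ℝ) := Real.one_le_sqrt.mpr hx1
  nlinarith

/-- The finite set of pairs (n, b). -/
noncomputable def pairs (m : ℤ) (x : ℕ) : Finset (ℕ × ℕ) := by
  classical
  exact (Ioc 0 x ×ˢ range x).filter fun p => Odd p.1 ∧ p.2 < p.1 ∧ (p.1 : ℤ) ∣ (p.2 : ℤ) ^ 2 - m

lemma mem_pairs (m : ℤ) (x : ℕ) (p : ℕ × ℕ) : p ∈ pairs m x ↔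
    p.1 ≤ x ∧ Odd p.1 ∧ p.2 < p.1 ∧ (p.1 : ℤ) ∣ (p.2 : ℤ) ^ 2 - m := by
  classical
  simp only [pairs, mem_filter, mem_product, mem_Ioc, mem_range]
  constructor
  · rintro ⟨⟨h1, h2⟩, h3⟩
    exact ⟨h1.2, h3⟩
  · rintro ⟨h1, h2, h3, h4⟩
    exact ⟨⟨⟨h2.pos, h1⟩, by omega⟩, h2, h3, h4⟩

lemma sum_rho (m : ℤ) (x : ℕ) : ∑ n ∈ Ioc 0 x, rho m n = (pairs m x).card := by
  classical
  rw [card_eq_sum_card_fiberwise (f := Prod.fst) (t := Ioc 0 x)]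
  · push_cast
    refine sum_congr rfl fun n hn => ?_
    rw [mem_Ioc] at hn
    have : NeZero n := ⟨by omega⟩
    rw [rho_apply]
    split_ifs with ho
    · congr 1
      rw [Nat.card_eq_fintype_card, Fintype.card_subtype]
      refine (card_bij (fun p _ => ((p.2 : ℕ) : ZMod n)) ?_ ?_ ?_).symm
      · rintro ⟨n', b⟩ h
        simp only [mem_filter, mem_pairs] at h
        obtain ⟨⟨-, -, -, h⟩, rfl⟩ := h
        simp only [mem_filter, mem_univ, true_and]
        have := (ZMod.intCast_zmod_eq_zero_iff_dvd _ _).mpr h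
        push_cast at this
        exact sub_eq_zero.mp this
      · rintro ⟨n1, b1⟩ h1 ⟨n2, b2⟩ h2 h
        simp only [mem_filter, mem_pairs] at h1 h2 h
        obtain ⟨⟨-, -, h1, -⟩, rfl⟩ := h1
        obtain ⟨⟨-, -, h2, -⟩, rfl⟩ := h2
        rw [ZMod.natCast_eq_natCast_iff', Nat.mod_eq_of_lt h1, Nat.mod_eq_of_lt h2] at h
        rw [h]
      · intro b hb
        simp only [mem_filter, mem_univ, true_and] at hb
        refine ⟨(n, b.val), ?_, by simp⟩
        simp only [mem_filter, mem_pairs, and_true]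
        refine ⟨hn.2, ho, ZMod.val_lt b, (ZMod.intCast_zmod_eq_zero_iff_dvd _ _).mp ?_⟩
        push_cast
        rw [ZMod.natCast_zmod_val, hb, sub_self]
    · symm
      rw [Nat.cast_eq_zero, card_eq_zero, filter_eq_empty_iff]
      rintro p hp rfl
      exact ho ((mem_pairs _ _ _).mp hp).2.1
  · intro p hp
    have := (mem_pairs _ _ _).mp hp
    simp only [coe_Ioc, Set.mem_Ioc]
    exact ⟨this.2.1.pos, this.1⟩

lemma count_bound {O : Type*} [CommRing O] [IsDedekindDomain O] [Fintype (ClassGroup O)]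
    (ι : O →+* ℂ) (hι : Function.Injective ι) (s : O) (D : ℝ) (hD : 0 < D)
    (hs : ι s = Complex.I * (Real.sqrt D : ℝ)) (m : ℤ) (hm : Squarefree m) (hsm : s ^ 2 = (m : O))
    (hO : ∀ x : O, ∃ u v : ℤ, 2 * x = u + v * s) (h2 : ¬ IsUnit (2 : O)) (x : ℕ) :
    ∑ n ∈ Ioc 0 x, rho m n ≤
      Fintype.card (ClassGroup O) * (24 * (x / Real.sqrt D) + 6 * Real.sqrt x) := by
  classical
  rw [sum_rho]
  obtain ⟨σ, hσ⟩ := exists_conj ι hι s D hs hO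
  have hne : ∀ p : ℕ × ℕ, Odd p.1 → idl s p.1 p.2 ∈ nonZeroDivisors (Ideal O) := by
    intro p hp
    apply mem_nonZeroDivisors_of_ne_zero
    intro h
    have : (p.1 : O) ∈ idl s p.1 p.2 := Ideal.subset_span (by simp)
    rw [h, Ideal.zero_eq_bot, Ideal.mem_bot] at this
    have := congrArg ι this
    rw [map_natCast, map_zero] at this
    exact hp.pos.ne' (by exact_mod_cast this)
  let cl : ℕ × ℕ → ClassGroup O := fun p =>
    if h : Odd p.1 then ClassGroup.mk0 ⟨idl s p.1 p.2, hne p h⟩ else 1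
  have hfib : ∀ c : ClassGroup O, ((((pairs m x).filter fun p => cl p = c).card : ℕ) : ℝ) ≤
      24 * (x / Real.sqrt D) + 6 * Real.sqrt x := by
    intro c
    rcases ((pairs m x).filter fun p => cl p = c).eq_empty_or_nonempty with he | ⟨q, hq⟩
    · rw [he]; simp; positivity
    rw [mem_filter, mem_pairs] at hq
    obtain ⟨⟨hq1, hq2, hq3, hq4⟩, hqc⟩ := hq
    have hex : ∀ p ∈ (pairs m x).filter fun p => cl p = c, ∃ w : O × O × O × ℤ × ℤ,
        w.1 ≠ 0 ∧ w.2.1 ≠ 0 ∧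
        Ideal.span {w.1} * idl s p.1 p.2 = Ideal.span {w.2.1} * idl s q.1 q.2 ∧
        w.1 * p.1 = w.2.1 * w.2.2.1 ∧ w.2.2.1 * σ w.2.2.1 = p.1 * q.1 ∧
        2 * w.2.2.1 = w.2.2.2.1 + w.2.2.2.2 * s ∧
        (q.1 : ℤ) ∣ w.2.2.2.1 + w.2.2.2.2 * q.2 := by
      intro p hp
      rw [mem_filter, mem_pairs] at hp
      obtain ⟨⟨hp1, hp2, hp3, hp4⟩, hpc⟩ := hp
      rw [← hqc] at hpc
      simp only [cl, dif_pos hp2, dif_pos hq2] at hpc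
      rw [ClassGroup.mk0_eq_mk0_iff] at hpc
      obtain ⟨a, b, ha, hb, hab⟩ := hpc
      obtain ⟨z, hz, hz1, hz2⟩ := same_class ι hι s D hD hs m hm hsm hO h2 σ hσ p.1 p.2 hp2 hp4
        q.1 q.2 hq2 hq4 a b ha hb hab
      obtain ⟨u, v, hu, hv⟩ := idl_coord s m hsm hO q.1 q.2 hq4 z hz
      exact ⟨(a, b, z, u, v), ha, hb, hab, hz1, hz2, hu, hv⟩
    choose! w hw using hex
    set F := ((pairs m x).filter fun p => cl p = c).image (fun p => (w p).2.2.2) with hF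
    have h20 : (2 : O) ≠ 0 := by
      intro h
      have := congrArg ι h
      rw [map_ofNat, map_zero] at this
      norm_num at this
    have hinj : Set.InjOn (fun p => (w p).2.2.2) ((pairs m x).filter fun p => cl p = c) := by
      rintro p1 hp1 p2 hp2 h
      obtain ⟨a1, a2, a3, a4, a5, a6, a7⟩ := hw p1 hp1
      obtain ⟨b1, b2, b3, b4, b5, b6, b7⟩ := hw p2 hp2
      simp only at h
      have hz : (w p1).2.2.1 = (w p2).2.2.1 := by
        apply mul_left_cancel₀ h20
        rw [a6, b6, h]
      have hq0 : (q.1 : ℂ) ≠ 0 := by exact_mod_cast hq2.pos.ne'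
      have hn : p1.1 = p2.1 := by
        rw [hz] at a5
        have := congrArg ι (a5.symm.trans b5)
        simp only [map_mul, map_natCast] at this
        exact_mod_cast mul_right_cancel₀ hq0 this
      have hp1' := (mem_pairs _ _ _).mp (mem_filter.mp hp1).1
      have hp2' := (mem_pairs _ _ _).mp (mem_filter.mp hp2).1
      rw [hz] at a4
      rw [← hn] at b3 b4 hp2'
      have hb := same_elt ι s D hD hs m hsm hO (idl s q.1 q.2) (w p2).2.2.1 p1.1 p1.2 p2.2 hp1'.2.1
        hp2'.2.2.2 hp1'.2.2.1 hp2'.2.2.1 _ _ _ _ a1 b2 a3 b3 a4 b4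
      exact Prod.ext hn hb
    rw [← card_image_of_injOn hinj]
    refine count_uv D hD x q.1 hq2.pos hq1 q.2 _ ?_ ?_
    · intro uv huv
      rw [mem_image] at huv
      obtain ⟨p, hp, rfl⟩ := huv
      obtain ⟨a1, a2, a3, a4, a5, a6, a7⟩ := hw p hp
      have hp' := (mem_pairs _ _ _).mp (mem_filter.mp hp).1
      have e1 := congrArg ι a5
      rw [map_mul, hσ, Complex.mul_conj, map_mul, map_natCast, map_natCast] at e1
      have e2 : Complex.normSq (ι (w p).2.2.1) = p.1 * q.1 := by exact_mod_cast e1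
      have e3 := congrArg (fun t => Complex.normSq (ι t)) a6
      simp only [map_mul, map_add, map_intCast, hs, map_ofNat, e2] at e3
      rw [Complex.normSq_apply (_ + _)] at e3
      simp at e3
      have hD2 : √D * √D = D := Real.mul_self_sqrt hD.le
      have hpx : (p.1 : ℝ) ≤ x := by exact_mod_cast hp'.1
      have hq0 : (0:ℝ) ≤ q.1 := by positivity
      have : ((w p).2.2.2.1 : ℝ) ^ 2 + D * ((w p).2.2.2.2 : ℝ) ^ 2 = 4 * (p.1 * q.1) := by
        norm_num at e3
        linear_combination -e3 - ((w p).2.2.2.2 : ℝ) ^ 2 * hD2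
      rw [this]
      nlinarith
    · intro uv huv
      rw [mem_image] at huv
      obtain ⟨p, hp, rfl⟩ := huv
      exact (hw p hp).2.2.2.2.2.2
  rw [card_eq_sum_card_fiberwise (f := cl) (t := univ) (by simp)]
  push_cast
  calc _ ≤ ∑ c : ClassGroup O, (24 * (x / Real.sqrt D) + 6 * Real.sqrt x) := sum_le_sum fun c _ => hfib c
    _ = _ := by rw [sum_const, nsmul_eq_mul, card_univ]
end HB
open Finset Filter Topology

namespace HB

/-- The chosen square root. -/
noncomputable def sqr (m : ℤ) : ℂ := Complex.I * (Real.sqrt (-(m : ℝ)) : ℝ)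

lemma sqr_sq (m : ℤ) (hm : m < 0) : sqr m ^ 2 = m := by
  have h : (0:ℝ) ≤ -(m:ℝ) := by
    have : (m:ℝ) < 0 := by exact_mod_cast hm
    linarith
  have h2 : ((Real.sqrt (-(m : ℝ)) : ℝ) : ℂ) ^ 2 = -(m : ℂ) := by
    rw [← Complex.ofReal_pow, Real.sq_sqrt h]; simp
  rw [sqr, mul_pow, Complex.I_sq, h2]; ring

lemma sqr_mem (m : ℤ) (hm : m < 0) : sqr m ∈ Qsqrt m :=
  IntermediateField.subset_adjoin _ _ (sqr_sq m hm)

lemma mem_coord (m : ℤ) (hm : m < 0) (z : ℂ) (hz : z ∈ Qsqrt m) :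
    ∃ p q : ℚ, z = p + q * sqr m := by
  have hs := sqr_sq m hm
  have hs0 : sqr m ≠ 0 := by
    intro h
    rw [h] at hs
    have : (m : ℂ) = 0 := by rw [← hs]; simp
    exact hm.ne (by exact_mod_cast this)
  rw [Qsqrt] at hz
  induction hz using IntermediateField.adjoin_induction with
  | mem x hx =>
    have hx' : x ^ 2 = sqr m ^ 2 := by rw [hs]; exact hx
    rcases sq_eq_sq_iff_eq_or_eq_neg.mp hx' with rfl | rfl
    · exact ⟨0, 1, by simp⟩
    · exact ⟨0, -1, by simp⟩
  | algebraMap x => exact ⟨x, 0, by simp⟩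
  | add x y hx hy h1 h2 =>
    obtain ⟨p, q, rfl⟩ := h1
    obtain ⟨p', q', rfl⟩ := h2
    exact ⟨p + p', q + q', by push_cast; ring⟩
  | mul x y hx hy h1 h2 =>
    obtain ⟨p, q, rfl⟩ := h1
    obtain ⟨p', q', rfl⟩ := h2
    exact ⟨p * p' + q * q' * m, p * q' + q * p', by push_cast; linear_combination (q : ℂ) * q' * hs⟩
  | inv x hx h1 =>
    obtain ⟨p, q, rfl⟩ := h1
    have hm' : (m : ℚ) < 0 := by exact_mod_cast hm
    by_cases h : p = 0 ∧ q = 0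
    · exact ⟨0, 0, by simp [h.1, h.2]⟩
    have hN : p ^ 2 - m * q ^ 2 ≠ 0 := by
      intro h0
      apply h
      have h1 : p ^ 2 = 0 := by nlinarith [sq_nonneg p, sq_nonneg q]
      have h2 : (m : ℚ) * q ^ 2 = 0 := by linarith
      exact ⟨by simpa using h1, by simpa [hm'.ne] using h2⟩
    have hN' : (p : ℂ) ^ 2 - m * q ^ 2 ≠ 0 := by exact_mod_cast hN
    refine ⟨p / (p ^ 2 - m * q ^ 2), - q / (p ^ 2 - m * q ^ 2), ?_⟩
    push_cast
    apply inv_eq_of_mul_eq_one_right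
    have e : (p : ℂ) ^ 2 - m * q ^ 2 = p ^ 2 - q ^ 2 * sqr m ^ 2 := by rw [hs]; ring
    rw [e] at hN' ⊢
    have : ((p : ℂ) + q * sqr m) * (p / (p ^ 2 - q ^ 2 * sqr m ^ 2) + -q / (p ^ 2 - q ^ 2 * sqr m ^ 2) * sqr m)
        = (p ^ 2 - q ^ 2 * sqr m ^ 2) / (p ^ 2 - q ^ 2 * sqr m ^ 2) := by ring
    rw [this, div_self hN']

lemma numField (m : ℤ) (hm : m < 0) : NumberField (Qsqrt m) := by
  have : FiniteDimensional ℚ (Qsqrt m) := by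
    rw [Qsqrt]
    have : Finite {z : ℂ | z ^ 2 = (m : ℂ)} := by
      refine Set.Finite.subset (s := {sqr m, - sqr m}) (by simp) ?_
      intro x hx
      have hx' : x ^ 2 = sqr m ^ 2 := by rw [sqr_sq m hm]; exact hx
      simpa using sq_eq_sq_iff_eq_or_eq_neg.mp hx'
    refine IntermediateField.finiteDimensional_adjoin fun x hx => ?_
    refine ⟨Polynomial.X ^ 2 - Polynomial.C (m : ℚ), Polynomial.monic_X_pow_sub_C _ (by norm_num), ?_⟩
    have hx : x ^ 2 = m := hx
    rw [Polynomial.eval₂_sub, Polynomial.eval₂_pow, Polynomial.eval₂_X, Polynomial.eval₂_C, hx]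
    simp
  exact {}

lemma int_of_integral (q : ℚ) (h : IsIntegral ℤ (q : ℂ)) : ∃ n : ℤ, q = n := by
  have h1 : IsIntegral ℤ (algebraMap ℚ ℂ q) := by simpa using h
  rw [isIntegral_algebraMap_iff (algebraMap ℚ ℂ).injective] at h1
  obtain ⟨n, hn⟩ := IsIntegrallyClosed.isIntegral_iff.mp h1
  exact ⟨n, by simpa using hn.symm⟩

lemma sqr_conj (m : ℤ) : starRingEnd ℂ (sqr m) = - sqr m := by
  simp [sqr]

lemma integral_coord (m : ℤ) (hm : m < 0) (hsf : Squarefree m) (z : ℂ) (hz : z ∈ Qsqrt m)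
    (hi : IsIntegral ℤ z) : ∃ u v : ℤ, 2 * z = u + v * sqr m := by
  obtain ⟨p, q, rfl⟩ := mem_coord m hm z hz
  have hs := sqr_sq m hm
  have hsi : IsIntegral ℤ (sqr m) := by
    refine IsIntegral.of_pow (n := 2) (by norm_num) ?_
    rw [hs]; exact isIntegral_algebraMap (R := ℤ) (x := m)
  have hc : IsIntegral ℤ ((p : ℂ) - q * sqr m) := by
    have := hi.map ((starRingEnd ℂ).toIntAlgHom)
    simpa [sqr_conj, ← sub_eq_add_neg] using this
  obtain ⟨u, hu⟩ := int_of_integral (2 * p) (by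
    have := hi.add hc
    rwa [show (p : ℂ) + q * sqr m + (p - q * sqr m) = ((2 * p : ℚ) : ℂ) by push_cast; ring] at this)
  obtain ⟨w, hw⟩ := int_of_integral (2 * q * m) (by
    have := (hi.sub hc).mul hsi
    rwa [show ((p : ℂ) + q * sqr m - (p - q * sqr m)) * sqr m = ((2 * q * m : ℚ) : ℂ) by
      push_cast; linear_combination 2 * (q : ℂ) * hs] at this)
  obtain ⟨t, ht⟩ := int_of_integral ((2 * q) ^ 2 * m) (by
    have := (hi.sub hc).mul (hi.sub hc)
    rwa [show ((p : ℂ) + q * sqr m - (p - q * sqr m)) * (p + q * sqr m - (p - q * sqr m)) =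
      (((2 * q) ^ 2 * m : ℚ) : ℂ) by
      push_cast; linear_combination 4 * (q : ℂ) ^ 2 * hs] at this)
  have hdvd : m ∣ w ^ 2 := by
    refine ⟨t, ?_⟩
    have : (w : ℚ) ^ 2 = m * t := by rw [← hw, ← ht]; ring
    exact_mod_cast this
  have hmw : m ∣ w := (hsf.dvd_pow_iff_dvd (by norm_num)).mp hdvd
  obtain ⟨v, rfl⟩ := hmw
  have hq : 2 * q = v := by
    have hm' : (m : ℚ) ≠ 0 := by exact_mod_cast hm.ne
    apply mul_right_cancel₀ hm'
    rw [hw]; push_cast; ring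
  refine ⟨u, v, ?_⟩
  have h1 : (2 : ℂ) * p = u := by exact_mod_cast congrArg (Rat.cast : ℚ → ℂ) hu
  have h2 : (2 : ℂ) * q = v := by exact_mod_cast congrArg (Rat.cast : ℚ → ℂ) hq
  linear_combination h1 + sqr m * h2

lemma rho_bound (m : ℤ) (hm : m < 0) (hsf : Squarefree m) [NumberField (Qsqrt m)] (x : ℕ) :
    ∑ n ∈ Ioc 0 x, rho m n ≤
      NumberField.classNumber (Qsqrt m) * (24 * (x / Real.sqrt (-(m : ℝ))) + 6 * Real.sqrt x) := by
  have hD : (0:ℝ) < -(m : ℝ) := by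
    have : (m : ℝ) < 0 := by exact_mod_cast hm
    linarith
  let K := Qsqrt m
  let O := NumberField.RingOfIntegers K
  let ι : O →+* ℂ := (algebraMap K ℂ).comp (algebraMap O K)
  have hι : Function.Injective ι :=
    (algebraMap K ℂ).injective.comp NumberField.RingOfIntegers.coe_injective
  have hint : ∀ z : K, IsIntegral ℤ z ↔ IsIntegral ℤ (z : ℂ) := fun z =>
    (isIntegral_algebraMap_iff (algebraMap K ℂ).injective).symm
  have hsi : IsIntegral ℤ (⟨sqr m, sqr_mem m hm⟩ : K) := by
    rw [hint]
    refine IsIntegral.of_pow (n := 2) (by norm_num) ?_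
    rw [sqr_sq m hm]; exact isIntegral_algebraMap (R := ℤ) (x := m)
  let s : O := ⟨⟨sqr m, sqr_mem m hm⟩, hsi⟩
  have hs : ι s = sqr m := rfl
  refine count_bound ι hι s _ hD hs m hsf ?_ ?_ ?_ x
  · apply hι
    rw [map_pow, hs, sqr_sq m hm, map_intCast]
  · intro z
    obtain ⟨u, v, h⟩ := integral_coord m hm hsf (ι z) (algebraMap O K z).2
      ((hint _).mp (NumberField.RingOfIntegers.isIntegral_coe z))
    refine ⟨u, v, hι ?_⟩
    rw [map_mul, map_ofNat, map_add, map_mul, map_intCast, map_intCast, hs]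
    exact h
  · intro h
    obtain ⟨e, he⟩ := h.exists_right_inv
    have hh : ι e = ((1 / 2 : ℚ) : ℂ) := by
      have := congrArg ι he
      rw [map_mul, map_ofNat, map_one] at this
      push_cast
      linear_combination this / 2
    have hie : IsIntegral ℤ (ι e) := (hint _).mp (NumberField.RingOfIntegers.isIntegral_coe e)
    rw [hh] at hie
    obtain ⟨n, hn⟩ := int_of_integral _ hie
    have : (1 : ℚ) = ((2 * n : ℤ) : ℚ) := by push_cast; linarith
    have : (1 : ℤ) = 2 * n := by exact_mod_cast this
    omega
end HB
open Finset Filter Topology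

namespace HB

lemma sum_le_ts (p : ℝ) (hp : p < -1) (N : ℕ) : ∑ k ∈ Ioc 0 N, (k : ℝ) ^ p ≤ ∑' k : ℕ, (k : ℝ) ^ p :=
  (Real.summable_nat_rpow.mpr hp).sum_le_tsum _ (fun k _ => by positivity)

lemma ts_nonneg (p : ℝ) : 0 ≤ ∑' k : ℕ, (k : ℝ) ^ p := tsum_nonneg fun k => by positivity

lemma sum_tenth (N : ℕ) : ∑ k ∈ Ioc 0 N, (k : ℝ) ^ (-(9/10) : ℝ) ≤ 10 * (N : ℝ) ^ (1/10 : ℝ) := by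
  induction N with
  | zero => simp
  | succ k ih =>
    rw [← Finset.insert_Ioc_right_eq_Ioc_add_one (by omega), sum_insert (by simp)]
    have hk : (0:ℝ) < (k + 1 : ℕ) := by positivity
    set y : ℝ := ((k + 1 : ℕ) : ℝ) with hy
    have hk' : (k : ℝ) = y * (1 + -(1 / y)) := by
      rw [hy]; push_cast; field_simp; ring
    have hy1 : 1 ≤ y := by rw [hy]; push_cast; linarith [(Nat.cast_nonneg k : (0:ℝ) ≤ k)]
    have hinv : 1 / y ≤ 1 := by rw [div_le_one hk]; exact hy1
    have hb := rpow_one_add_le_one_add_mul_self (s := -(1/y)) (by linarith) (p := 1/10) (by norm_num) (by norm_num)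
    have e : (k : ℝ) ^ (1/10 : ℝ) = y ^ (1/10 : ℝ) * (1 + -(1 / y)) ^ (1/10 : ℝ) := by
      rw [hk', Real.mul_rpow hk.le (by linarith)]
    have e2 : y ^ (-(9/10) : ℝ) = y ^ (1/10 : ℝ) * (1 / y) := by
      rw [show (-(9/10) : ℝ) = 1/10 - 1 by norm_num, Real.rpow_sub hk, Real.rpow_one]; ring
    have hp : 0 < y ^ (1/10 : ℝ) := by positivity
    have := mul_le_mul_of_nonneg_left hb hp.le
    rw [← e] at this
    rw [e2]
    nlinarith

lemma sqrt_le_sum (x : ℕ) : Real.sqrt x ≤ ∑ k ∈ Ioc 0 x, (k : ℝ) ^ (-(1/2) : ℝ) := by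
  rcases Nat.eq_zero_or_pos x with rfl | hx
  · simp
  have hx' : (0:ℝ) < x := by positivity
  calc Real.sqrt x = ∑ k ∈ Ioc 0 x, (x : ℝ) ^ (-(1/2) : ℝ) := by
        rw [sum_const, Nat.card_Ioc, nsmul_eq_mul, Real.sqrt_eq_rpow, Nat.sub_zero]
        nth_rewrite 2 [← Real.rpow_one (x : ℝ)]
        rw [← Real.rpow_add hx']; norm_num
    _ ≤ _ := by
        refine sum_le_sum fun k hk => ?_
        rw [mem_Ioc] at hk
        exact Real.rpow_le_rpow_of_nonpos (by exact_mod_cast hk.1) (by exact_mod_cast hk.2) (by norm_num)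

lemma rho_sum (d : ℝ) (m : ℤ) (D : ℝ) (hD : 0 < D)
    (h : ∀ x : ℕ, ∑ n ∈ Ioc 0 x, rho m n ≤ d * (24 * (x / Real.sqrt D) + 6 * Real.sqrt x))
    (hd : 0 ≤ d) (N : ℕ) :
    ∑ n ∈ Ioc 0 N, rho m n * (n : ℝ) ^ (-(9/10) : ℝ) ≤
      d * (240 * ((N : ℝ) ^ (1/10 : ℝ) / Real.sqrt D) + 6 * ∑' k : ℕ, (k : ℝ) ^ (-(14/10) : ℝ)) := by
  have hsD : 0 < √D := Real.sqrt_pos.mpr hD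
  have := abel_compare (fun k => d * (24 / Real.sqrt D + 6 * (k : ℝ) ^ (-(1/2) : ℝ)) - rho m k)
    (fun n => (n : ℝ) ^ (-(9/10) : ℝ)) (fun n hn => rpow_anti _ (by norm_num) n hn)
    (fun n => by positivity) (fun M => by
      rw [sum_sub_distrib, ← mul_sum, sum_add_distrib, ← mul_sum, sum_const, Nat.card_Ioc,
        nsmul_eq_mul, Nat.sub_zero, sub_nonneg]
      refine (h M).trans (mul_le_mul_of_nonneg_left ?_ hd)
      have := sqrt_le_sum M
      have e : (M : ℝ) * (24 / √D) = 24 * (M / √D) := by ring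
      rw [e]; linarith) N
  simp only [sub_mul, sum_sub_distrib, sub_nonneg] at this
  refine this.trans ?_
  simp only [mul_assoc, ← mul_sum]
  refine mul_le_mul_of_nonneg_left ?_ hd
  simp only [add_mul, sum_add_distrib, mul_assoc, ← mul_sum]
  refine add_le_add ?_ ?_
  · calc 24 / √D * ∑ i ∈ Ioc 0 N, (i : ℝ) ^ (-(9/10) : ℝ) ≤ 24 / √D * (10 * (N : ℝ) ^ (1/10 : ℝ)) := by
          gcongr; exact sum_tenth N
      _ = _ := by ring
  · refine mul_le_mul_of_nonneg_left ?_ (by norm_num)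
    refine le_trans (le_of_eq ?_) (sum_le_ts _ (by norm_num) N)
    refine sum_congr rfl fun k hk => ?_
    rw [mem_Ioc] at hk
    rw [← Real.rpow_add (by exact_mod_cast hk.1)]; norm_num

lemma sq_sum (N : ℕ) : ∑ n ∈ Ioc 0 N, sq n * (n : ℝ) ^ (-(9/10) : ℝ) ≤ ∑' k : ℕ, (k : ℝ) ^ (-(18/10) : ℝ) := by
  classical
  refine le_trans ?_ (sum_le_ts _ (by norm_num) N)
  have hinj : Set.InjOn (fun k : ℕ => k * k) (Ioc 0 N) := fun a _ b _ h => Nat.mul_self_inj.mp h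
  calc _ = ∑ n ∈ (Ioc 0 N).filter IsSquare, (n : ℝ) ^ (-(9/10) : ℝ) := by
        rw [sum_filter]
        refine sum_congr rfl fun n hn => ?_
        rw [mem_Ioc] at hn
        rw [sq_apply]
        simp only [show n ≠ 0 by omega, ne_eq, not_false_eq_true, and_true]
        split_ifs <;> simp
    _ ≤ ∑ n ∈ (Ioc 0 N).image (fun k : ℕ => k * k), (n : ℝ) ^ (-(9/10) : ℝ) := by
        refine sum_le_sum_of_subset_of_nonneg ?_ (fun _ _ _ => by positivity)
        intro n hn
        rw [mem_filter, mem_Ioc] at hn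
        obtain ⟨⟨h1, h2⟩, k, rfl⟩ := hn
        have : 0 < k := Nat.pos_of_mul_pos_left h1
        refine mem_image.mpr ⟨k, mem_Ioc.mpr ⟨this, ?_⟩, rfl⟩
        nlinarith
    _ = ∑ k ∈ Ioc 0 N, (k : ℝ) ^ (-(18/10) : ℝ) := by
        rw [sum_image hinj]
        refine sum_congr rfl fun k hk => ?_
        rw [mem_Ioc] at hk
        have : (0:ℝ) < k := by exact_mod_cast hk.1
        push_cast
        rw [Real.mul_rpow this.le this.le, ← Real.rpow_add this]; norm_num

lemma r_sum (m : ℤ) (N : ℕ) : ∑ n ∈ Ioc 0 N, r m n * (n : ℝ) ^ (-(9/10) : ℝ) ≤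
    (∑' k : ℕ, (k : ℝ) ^ (-(18/10) : ℝ)) * ∑ n ∈ Ioc 0 N, rho m n * (n : ℝ) ^ (-(9/10) : ℝ) := by
  have h0 : ∀ n, 0 ≤ rho m n * (n : ℝ) ^ (-(9/10) : ℝ) := fun n => mul_nonneg (rho_nonneg _ _) (by positivity)
  have h1 : ∀ n, 0 ≤ sq n * (n : ℝ) ^ (-(9/10) : ℝ) := fun n => mul_nonneg (sq_nonneg' _) (by positivity)
  calc _ ≤ S (sq * rho m) (9/10) N := by
        rw [S]
        refine sum_le_sum fun n _ => ?_
        rw [tw_apply]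
        exact mul_le_mul_of_nonneg_right (r_le_sqrho m n) (by positivity)
    _ ≤ ∑ x ∈ Ioc 0 N ×ˢ Ioc 0 N, tw sq (9/10) x.1 * tw (rho m) (9/10) x.2 := by
        rw [S_mul]
        exact sum_le_sum_of_subset_of_nonneg (filter_subset _ _) fun x _ _ => mul_nonneg (h1 _) (h0 _)
    _ = (∑ n ∈ Ioc 0 N, sq n * (n : ℝ) ^ (-(9/10) : ℝ)) * ∑ n ∈ Ioc 0 N, rho m n * (n : ℝ) ^ (-(9/10) : ℝ) := by
        rw [sum_mul_sum, sum_product]; rfl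
    _ ≤ _ := by
        gcongr
        · exact sum_nonneg fun n _ => h0 n
        · exact sq_sum N

lemma lemE (d : ℕ) : ∃ C : ℝ, 1 ≤ C ∧ ∀ m : ℤ, m < 0 → Squarefree m →
    (∀ [NumberField (Qsqrt m)], NumberField.classNumber (Qsqrt m) = d) →
    ∑ n ∈ Ioc 0 (m.natAbs ^ 4), r m n * (n : ℝ) ^ (-(9/10) : ℝ) ≤ C := by
  refine ⟨max 1 ((∑' k : ℕ, (k : ℝ) ^ (-(18/10) : ℝ)) *
    (d * (240 + 6 * ∑' k : ℕ, (k : ℝ) ^ (-(14/10) : ℝ)))), le_max_left _ _, fun m hm hsf hcl => ?_⟩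
  refine le_trans ?_ (le_max_right _ _)
  refine (r_sum m _).trans (mul_le_mul_of_nonneg_left ?_ (ts_nonneg _))
  have : NumberField (Qsqrt m) := numField m hm
  have hD : (0:ℝ) < -(m : ℝ) := by
    have : (m : ℝ) < 0 := by exact_mod_cast hm
    linarith
  have hb := rho_sum d m (-(m:ℝ)) hD (fun x => by
    have := rho_bound m hm hsf x
    rwa [hcl] at this) (by positivity) (m.natAbs ^ 4)
  refine hb.trans (mul_le_mul_of_nonneg_left ?_ (by positivity))
  have hN : ((m.natAbs : ℕ) : ℝ) = -(m : ℝ) := by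
    rw [Nat.cast_natAbs]
    push_cast
    exact abs_of_neg (by linarith)
  have h1 : (1:ℝ) ≤ -(m:ℝ) := by
    rw [← hN]; exact_mod_cast Int.natAbs_pos.mpr hm.ne
  have : (((m.natAbs ^ 4 : ℕ) : ℝ) ^ (1/10 : ℝ) / Real.sqrt (-(m : ℝ))) ≤ 1 := by
    rw [div_le_one (Real.sqrt_pos.mpr hD), Nat.cast_pow, hN, ← Real.rpow_natCast, ← Real.rpow_mul hD.le,
      Real.sqrt_eq_rpow]
    exact Real.rpow_le_rpow_of_exponent_le h1 (by norm_num)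
  linarith
end HB
open Finset Filter Topology

namespace HB

/-- Dirichlet polynomial 1 - 3 * 3^(-s). -/
noncomputable def ef : ArithmeticFunction ℝ :=
  ⟨fun n => (if n = 1 then 1 else 0) + (if n = 3 then -3 else 0), by simp⟩

lemma ef_apply (n : ℕ) : ef n = (if n = 1 then 1 else 0) + (if n = 3 then -3 else 0) := rfl

/-- Periodic function. -/
noncomputable def af : ArithmeticFunction ℝ := ef * oddz

lemma af_apply (n : ℕ) : af n = if Odd n then (if 3 ∣ n then -2 else 1) else 0 := by
  rcases eq_or_ne n 0 with rfl | hn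
  · simp
  rw [af, ArithmeticFunction.mul_apply, Nat.sum_divisorsAntidiagonal (f := fun i j => ef i * oddz j)]
  simp only [ef_apply, add_mul, ite_mul, zero_mul, sum_add_distrib, sum_ite_eq', Nat.mem_divisors,
    one_dvd, ne_eq, hn, not_false_eq_true, and_true, if_true, Nat.div_one, one_mul, oddz_apply]
  by_cases h3 : 3 ∣ n
  · obtain ⟨k, rfl⟩ := h3
    have : Odd (3 * k) ↔ Odd k := by rw [Nat.odd_mul]; simp [show Odd 3 by decide]
    simp only [this, dvd_mul_right, if_true, Nat.mul_div_cancel_left k (by norm_num : 0 < 3)]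
    split_ifs <;> norm_num
  · simp [h3]

lemma af_abs (n : ℕ) : |af n| ≤ 2 := by
  rw [af_apply]; split_ifs <;> norm_num

lemma af_partial (k : ℕ) : |∑ n ∈ Ioc 0 k, af n| ≤ 12 := by
  have := partial_bound' af 6 (by norm_num) 2 af_abs (fun n => by
    have h1 : Odd (n % 6) ↔ Odd n := by
      rw [Nat.odd_iff, Nat.odd_iff, Nat.mod_mod_of_dvd _ (by norm_num)]
    have h2 : 3 ∣ n % 6 ↔ 3 ∣ n := by omega
    simp only [af_apply, h1, h2]) (by
    simp only [Finset.sum_range_succ, Finset.sum_range_zero, af_apply, Nat.odd_iff]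
    norm_num) k
  norm_num at this
  exact this

lemma triple (a b c σ : ℝ) (ha : 0 < a) (hb : 0 < b) (hc : 0 < c) (h : a * c < b ^ 2) (hσ : 0 < σ) :
    2 * b ^ (-σ) < a ^ (-σ) + c ^ (-σ) := by
  have h1 : (b ^ (-σ)) ^ 2 < a ^ (-σ) * c ^ (-σ) := by
    rw [← Real.mul_rpow ha.le hc.le, ← Real.rpow_natCast, ← Real.rpow_mul hb.le, mul_comm (-σ),
      Real.rpow_mul hb.le, Real.rpow_natCast]
    exact Real.rpow_lt_rpow_of_neg (by positivity) h (by linarith)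
  have hp : 0 < a ^ (-σ) := by positivity
  have hq : 0 < c ^ (-σ) := by positivity
  have ht : 0 < b ^ (-σ) := by positivity
  nlinarith [sq_nonneg (a ^ (-σ) - c ^ (-σ))]

lemma S_af_step (σ : ℝ) (hσ : 0 < σ) (k : ℕ) : S af σ (6 * k) < S af σ (6 * (k + 1)) := by
  have h : ∀ N, S af σ (N + 1) = S af σ N + tw af σ (N + 1) := by
    intro N
    rw [S, S, ← Finset.insert_Ioc_right_eq_Ioc_add_one (by omega), sum_insert (by simp), add_comm]
  rw [show 6 * (k + 1) = 6 * k + 1 + 1 + 1 + 1 + 1 + 1 by ring]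
  simp only [h, tw_apply, af_apply]
  have o1 : Odd (6 * k + 1) := by rw [Nat.odd_iff]; omega
  have o2 : ¬ Odd (6 * k + 1 + 1) := by rw [Nat.odd_iff]; omega
  have o3 : Odd (6 * k + 1 + 1 + 1) := by rw [Nat.odd_iff]; omega
  have o4 : ¬ Odd (6 * k + 1 + 1 + 1 + 1) := by rw [Nat.odd_iff]; omega
  have o5 : Odd (6 * k + 1 + 1 + 1 + 1 + 1) := by rw [Nat.odd_iff]; omega
  have o6 : ¬ Odd (6 * k + 1 + 1 + 1 + 1 + 1 + 1) := by rw [Nat.odd_iff]; omega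
  have d1 : ¬ 3 ∣ 6 * k + 1 := by omega
  have d3 : 3 ∣ 6 * k + 1 + 1 + 1 := by omega
  have d5 : ¬ 3 ∣ 6 * k + 1 + 1 + 1 + 1 + 1 := by omega
  simp only [o1, o2, o3, o4, o5, o6, d1, d3, d5, if_true, if_false]
  have := triple ((6 * k + 1 : ℕ) : ℝ) ((6 * k + 1 + 1 + 1 : ℕ) : ℝ) ((6 * k + 1 + 1 + 1 + 1 + 1 : ℕ) : ℝ) σ
    (by positivity) (by positivity) (by positivity) (by push_cast; nlinarith) hσ
  linarith

lemma Lf_af_pos (σ : ℝ) (hσ : 0 < σ) : 0 < Lf af σ := by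
  have h0 : 0 < S af σ (6 * (0 + 1)) := by
    have := S_af_step σ hσ 0
    simpa [S] using this
  have h1 : ∀ k, S af σ (6 * (0 + 1)) ≤ S af σ (6 * (k + 1)) := by
    intro k
    induction k with
    | zero => exact le_rfl
    | succ k ih => exact ih.trans (S_af_step σ hσ (k + 1)).le
  have ht := S_tendsto af 12 af_partial σ hσ
  have ht' : Tendsto (fun k : ℕ => S af σ (6 * (k + 1))) atTop (𝓝 (Lf af σ)) := by
    refine ht.comp (tendsto_atTop_mono (fun k => ?_) tendsto_id)
    simp only [id]; omega
  exact h0.trans_le (ge_of_tendsto' ht' h1)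

lemma Lf_chi_two (m : ℤ) (hm : m < 0) : 0 < Lf (chi m) 2 := by
  have h : ∀ N, S (chi m) 2 (N + 1) = S (chi m) 2 N + tw (chi m) 2 (N + 1) := by
    intro N
    rw [S, S, ← Finset.insert_Ioc_right_eq_Ioc_add_one (by omega), sum_insert (by simp), add_comm]
  have hlow : ∀ n : ℕ, -(1 / (n : ℝ) ^ 2) ≤ tw (chi m) 2 n := by
    intro n
    rw [tw_apply]
    have e : (n : ℝ) ^ (-2 : ℝ) = 1 / (n : ℝ) ^ 2 := by
      rw [Real.rpow_neg (by positivity), one_div]; norm_cast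
    rw [e]
    have := (abs_le.mp (chi_abs m n)).1
    have : 0 ≤ 1 / (n : ℝ) ^ 2 := by positivity
    nlinarith
  have key : ∀ N : ℕ, 1 / 4 + 1 / ((N : ℝ) + 2) ≤ S (chi m) 2 (N + 2) := by
    intro N
    induction N with
    | zero =>
      rw [show 0 + 2 = 0 + 1 + 1 by rfl, h, h]
      have h0 : S (chi m) 2 0 = 0 := by simp [S]
      have h1 : tw (chi m) 2 (0 + 1) = 1 := by rw [tw_apply, zero_add, chi_one]; simp
      have h2 := hlow (0 + 1 + 1)
      rw [h0, h1]
      norm_num at h2 ⊢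
      linarith
    | succ N ih =>
      rw [show N + 1 + 2 = N + 2 + 1 by ring, h]
      have h2 := hlow (N + 2 + 1)
      push_cast at h2 ⊢
      have : 1 / ((N : ℝ) + 1 + 2) + 1 / ((N : ℝ) + 2 + 1) ^ 2 ≤ 1 / ((N : ℝ) + 2) := by
        rw [show (N : ℝ) + 1 + 2 = N + 3 by ring, show (N : ℝ) + 2 + 1 = N + 3 by ring,
          div_add_div _ _ (by positivity) (by positivity), div_le_div_iff₀ (by positivity) (by positivity)]
        have : (0:ℝ) ≤ N := by positivity
        nlinarith [mul_nonneg this this]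
      linarith
  have ht := (S_tendsto (chi m) _ (chi_partial m hm) 2 (by norm_num)).comp (tendsto_add_atTop_nat 2)
  have : (1/4 : ℝ) ≤ Lf (chi m) 2 := by
    refine ge_of_tendsto' ht fun N => le_trans ?_ (key N)
    have : (0:ℝ) ≤ 1 / ((N : ℝ) + 2) := by positivity
    linarith
  linarith

lemma S_ef (f : ArithmeticFunction ℝ) (σ : ℝ) (N : ℕ) (hN : 3 ≤ N) :
    S (ef * f) σ N = S f σ N - 3 * (3 : ℝ) ^ (-σ) * S f σ (N / 3) := by
  rw [S, tw_mul, ArithmeticFunction.sum_Ioc_mul_eq_sum_sum]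
  simp only [tw_apply ef, ef_apply, add_mul, ite_mul, zero_mul, sum_add_distrib, sum_ite_eq', mem_Ioc]
  rw [if_pos (by omega), if_pos (by omega)]
  simp [S]
  ring

/-- Splitting of exponents on tails. -/
lemma tail_le (m : ℤ) (C s : ℝ) (hs : 19/20 ≤ s) (K L N : ℕ) (hK : 0 < K) (hKL : K ≤ L)
    (hC : ∑ n ∈ Ioc 0 N, r m n * (n : ℝ) ^ (-(9/10) : ℝ) ≤ C) :
    ∑ n ∈ Ioc L N, r m n * (n : ℝ) ^ (-s) ≤ (K : ℝ) ^ (-(1/20) : ℝ) * C := by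
  have hK' : (0:ℝ) < K := by positivity
  calc _ ≤ ∑ n ∈ Ioc L N, (K : ℝ) ^ (-(1/20) : ℝ) * (r m n * (n : ℝ) ^ (-(9/10) : ℝ)) := by
        refine sum_le_sum fun n hn => ?_
        rw [mem_Ioc] at hn
        have hn0 : (0:ℝ) < n := by exact_mod_cast (by omega : 0 < n)
        have hn1 : (1:ℝ) ≤ n := by exact_mod_cast (by omega : 1 ≤ n)
        have e : (n : ℝ) ^ (-s) ≤ (K : ℝ) ^ (-(1/20) : ℝ) * (n : ℝ) ^ (-(9/10) : ℝ) := by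
          calc (n : ℝ) ^ (-s) ≤ (n : ℝ) ^ (-(1/20) + -(9/10) : ℝ) :=
                Real.rpow_le_rpow_of_exponent_le hn1 (by linarith)
            _ = (n : ℝ) ^ (-(1/20) : ℝ) * (n : ℝ) ^ (-(9/10) : ℝ) := Real.rpow_add hn0 _ _
            _ ≤ _ := by
                refine mul_le_mul_of_nonneg_right ?_ (by positivity)
                exact Real.rpow_le_rpow_of_nonpos hK' (by exact_mod_cast (by omega : K ≤ n)) (by norm_num)
        nlinarith [r_nonneg m n]
    _ ≤ ∑ n ∈ Ioc 0 N, (K : ℝ) ^ (-(1/20) : ℝ) * (r m n * (n : ℝ) ^ (-(9/10) : ℝ)) := by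
        refine sum_le_sum_of_subset_of_nonneg (Ioc_subset_Ioc_left (by omega)) fun n _ _ => ?_
        have := r_nonneg m n
        positivity
    _ ≤ _ := by
        rw [← mul_sum]
        exact mul_le_mul_of_nonneg_left hC (by positivity)

lemma full_le (m : ℤ) (C s : ℝ) (hs : 19/20 ≤ s) (N : ℕ)
    (hC : ∑ n ∈ Ioc 0 N, r m n * (n : ℝ) ^ (-(9/10) : ℝ) ≤ C) :
    ∑ n ∈ Ioc 0 N, r m n * (n : ℝ) ^ (-s) ≤ C := by
  refine le_trans (sum_le_sum fun n hn => ?_) hC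
  rw [mem_Ioc] at hn
  refine mul_le_mul_of_nonneg_left ?_ (r_nonneg m n)
  exact Real.rpow_le_rpow_of_exponent_le (by exact_mod_cast hn.1) (by linarith)

lemma tend_neg (c p : ℝ) (hp : 0 < p) : Tendsto (fun D : ℕ => c * (D : ℝ) ^ (-p)) atTop (𝓝 0) := by
  have := ((tendsto_rpow_neg_atTop hp).comp tendsto_natCast_atTop_atTop).const_mul c
  simpa using this

lemma D_pow (D : ℕ) (hD : 0 < D) : (D : ℝ) * ((D ^ 2 : ℕ) : ℝ) ^ (-(9/10) : ℝ) = (D : ℝ) ^ (-(8/10) : ℝ) := by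
  have h : (0:ℝ) < D := by positivity
  rw [Nat.cast_pow, ← Real.rpow_natCast, ← Real.rpow_mul h.le]
  nth_rewrite 1 [← Real.rpow_one (D : ℝ)]
  rw [← Real.rpow_add h]; norm_num

lemma D_pow' (D : ℕ) (hD : 0 < D) : ((D ^ 2 : ℕ) : ℝ) ^ (-(1/20) : ℝ) = (D : ℝ) ^ (-(1/10) : ℝ) := by
  have h : (0:ℝ) < D := by positivity
  rw [Nat.cast_pow, ← Real.rpow_natCast, ← Real.rpow_mul h.le]
  norm_num

lemma step1 (C : ℝ) : ∀ᶠ D : ℕ in atTop, ∀ m : ℤ, m < 0 → m.natAbs = D →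
    ∑ n ∈ Ioc 0 (D ^ 4), r m n * (n : ℝ) ^ (-(9/10) : ℝ) ≤ C →
    ∃ β : ℝ, 19/20 ≤ β ∧ Lf (chi m) β = 0 := by
  have hpos : (0:ℝ) < 3 ^ (1/20 : ℝ) - 1 := by
    have := Real.one_lt_rpow (x := 3) (z := 1/20) (by norm_num) (by norm_num)
    linarith
  have ht := (tend_neg C (1/10) (by norm_num)).add (tend_neg 576 (8/10) (by norm_num))
  rw [add_zero] at ht
  filter_upwards [ht.eventually (gt_mem_nhds hpos), eventually_ge_atTop 2] with D hD hD2 m hm hmD hC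
  have hD0 : 0 < D := by omega
  have hN3 : D ^ 2 ≤ D ^ 4 / 3 := by
    rw [Nat.le_div_iff_mul_le (by norm_num)]
    calc D ^ 2 * 3 ≤ D ^ 2 * D ^ 2 := Nat.mul_le_mul_left _ (by nlinarith)
      _ = D ^ 4 := by ring
  have hN : 3 ≤ D ^ 4 := by
    have : 0 < D ^ 2 := by positivity
    omega
  have hcb := conv_bound af (chi m) 12 (4 * D) (by norm_num)
    (by have : (2:ℝ) ≤ D := by exact_mod_cast hD2
        linarith) af_partial
    (fun k => by have := chi_partial m hm k; rwa [hmD] at this) af_abs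
    (fun n => (chi_abs m n).trans (by norm_num)) (19/20) le_rfl (D ^ 2) (by positivity)
  rw [show (D ^ 2) ^ 2 = D ^ 4 by ring, af, mul_assoc, ← r, S_ef _ _ _ hN, ← af] at hcb
  have e1 : S (r m) (19/20) (D ^ 4) = S (r m) (19/20) (D ^ 4 / 3) +
      ∑ n ∈ Ioc (D ^ 4 / 3) (D ^ 4), r m n * (n : ℝ) ^ (-(19/20) : ℝ) := by
    exact (sum_Ioc_consecutive (fun n => tw (r m) (19/20) n) (Nat.zero_le _) (Nat.div_le_self (D ^ 4) 3)).symm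
  have e2 := tail_le m C (19/20) le_rfl (D ^ 2) (D ^ 4 / 3) (D ^ 4) (by positivity) hN3 hC
  rw [D_pow' D hD0] at e2
  have e3 : 1 ≤ S (r m) (19/20) (D ^ 4 / 3) := by
    have : tw (r m) (19/20) 1 = 1 := by rw [tw_apply, (r_mult m).1]; simp
    rw [S, ← this]
    refine single_le_sum (f := fun n => tw (r m) (19/20) n) (fun n _ => ?_) ?_
    · rw [tw_apply]; exact mul_nonneg (r_nonneg m n) (by positivity)
    · rw [mem_Ioc]
      have : 0 < D ^ 2 := by positivity
      omega
  have e4 : (3:ℝ) * 3 ^ (-(19/20) : ℝ) = 3 ^ (1/20 : ℝ) := by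
    nth_rewrite 1 [← Real.rpow_one (3 : ℝ)]
    rw [← Real.rpow_add (by norm_num)]; norm_num
  have e5 : 12 * 12 * (4 * (D : ℝ)) * ((D ^ 2 : ℕ) : ℝ) ^ (-(9/10) : ℝ) = 576 * (D : ℝ) ^ (-(8/10) : ℝ) := by
    rw [← D_pow D hD0]; ring
  rw [e4, e5, e1] at hcb
  have hcb' := (abs_le.mp hcb).1
  have hneg : Lf af (19/20) * Lf (chi m) (19/20) < 0 := by
    nlinarith
  have hLneg : Lf (chi m) (19/20) < 0 := by
    by_contra h
    push Not at h
    have := mul_nonneg (Lf_af_pos (19/20) (by norm_num)).le h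
    linarith
  have hcont := (L_cont (chi m) _ (chi_partial m hm) (19/20) (by norm_num)).mono
    (Set.Icc_subset_Ici_self : Set.Icc (19/20 : ℝ) 2 ⊆ _)
  obtain ⟨β, hβ, h0⟩ := intermediate_value_Icc (by norm_num) hcont ⟨hLneg.le, (Lf_chi_two m hm).le⟩
  exact ⟨β, hβ.1, h0⟩

lemma step2 (C : ℝ) (m₁ : ℤ) (hm₁ : m₁ < 0) (β : ℝ) (hβ : 19/20 ≤ β) (h0 : Lf (chi m₁) β = 0) :
    ∀ᶠ D : ℕ in atTop, ∀ m : ℤ, m < 0 → Squarefree m → m.natAbs = D →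
    ∑ n ∈ Ioc 0 (D ^ 4), r m n * (n : ℝ) ^ (-(9/10) : ℝ) ≤ C → False := by
  set a : ℝ := (m₁.natAbs : ℝ) with ha
  have ha1 : 1 ≤ a := by
    rw [ha]; exact_mod_cast Int.natAbs_pos.mpr hm₁.ne
  have ht := (tend_neg (12 * (4 * a) * (4 * a) * C) (8/10) (by norm_num)).add
    (tend_neg (2 * C ^ 2) (1/10) (by norm_num))
  rw [add_zero] at ht
  filter_upwards [ht.eventually (gt_mem_nhds (zero_lt_one)), eventually_ge_atTop 2,
    eventually_gt_atTop (2 * m₁.natAbs)] with D hD hD2 hDm m hm hsf hmD hC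
  have hD0 : 0 < D := by omega
  set ψ := chi m₁ with hψ
  have hψo : ψ.pmul oddz = ψ := by
    ext n
    rw [ArithmeticFunction.pmul_apply, hψ, chi_apply, oddz_apply]
    split_ifs <;> simp
  have hG : ψ.pmul (r m) = ψ * ψ.pmul (chi m) := by
    rw [r, pmul_conv _ _ _ (chi_mul m₁), hψo]
  have hGG : ψ.pmul (r m) * ψ.pmul (r' m) = 1 := by
    rw [← pmul_conv _ _ _ (chi_mul m₁), r_mul_r']
    ext n
    rw [ArithmeticFunction.pmul_apply, ArithmeticFunction.one_apply]
    split_ifs with h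
    · rw [h, chi_one]; simp
    · simp
  have hcb := conv_bound ψ (ψ.pmul (chi m)) (4 * a) (4 * a * D) (by linarith)
    (by have : (2:ℝ) ≤ D := by exact_mod_cast hD2
        nlinarith) (chi_partial m₁ hm₁)
    (fun k => by have := prod_partial m₁ m hm₁.ne hsf (by omega) k; rwa [hmD] at this)
    (fun n => (chi_abs m₁ n).trans (by norm_num))
    (fun n => by
      rw [ArithmeticFunction.pmul_apply, abs_mul]
      have h1 := chi_abs m₁ n
      have h2 := chi_abs m n
      have := mul_le_mul h1 h2 (abs_nonneg _) (by norm_num)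
      linarith) β hβ (D ^ 2) (by positivity)
  rw [h0, zero_mul, sub_zero, ← hG, show (D ^ 2) ^ 2 = D ^ 4 by ring] at hcb
  have e5 : 12 * (4 * a) * (4 * a * D) * ((D ^ 2 : ℕ) : ℝ) ^ (-(9/10) : ℝ) =
      12 * (4 * a) * (4 * a) * (D : ℝ) ^ (-(8/10) : ℝ) := by
    rw [← D_pow D hD0]; ring
  rw [e5] at hcb
  set N := D ^ 4 with hN
  set w : ℕ → ℝ := fun n => r m n * (n : ℝ) ^ (-β) with hw
  have hw0 : ∀ n, 0 ≤ w n := fun n => mul_nonneg (r_nonneg m n) (by positivity)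
  have hg1 : ∀ n, |tw (ψ.pmul (r m)) β n| ≤ w n := by
    intro n
    rw [tw_apply, ArithmeticFunction.pmul_apply, abs_mul, abs_mul, abs_of_nonneg (r_nonneg m n),
      abs_of_nonneg (by positivity : 0 ≤ (n : ℝ) ^ (-β))]
    refine mul_le_mul_of_nonneg_right ?_ (by positivity)
    exact mul_le_of_le_one_left (r_nonneg m n) (chi_abs m₁ n)
  have hg2 : ∀ n, |tw (ψ.pmul (r' m)) β n| ≤ w n := by
    intro n
    rw [tw_apply, ArithmeticFunction.pmul_apply, abs_mul, abs_mul,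
      abs_of_nonneg (by positivity : 0 ≤ (n : ℝ) ^ (-β))]
    refine mul_le_mul_of_nonneg_right ?_ (by positivity)
    exact (mul_le_of_le_one_left (abs_nonneg _) (chi_abs m₁ n)).trans (abs_r'_le m n)
  have hfull : ∑ n ∈ Ioc 0 N, w n ≤ C := full_le m C β hβ N hC
  have htail : ∑ n ∈ Ioc (D ^ 2) N, w n ≤ (D : ℝ) ^ (-(1/10) : ℝ) * C := by
    rw [← D_pow' D hD0]
    exact tail_le m C β hβ (D ^ 2) (D ^ 2) N (by positivity) le_rfl hC
  have hC0 : 0 ≤ C := (sum_nonneg fun n _ => hw0 n).trans hfull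
  have hQ : |S (ψ.pmul (r' m)) β N| ≤ C :=
    (abs_sum_le_sum_abs _ _).trans ((sum_le_sum fun n _ => hg2 n).trans hfull)
  have hprod : S (ψ.pmul (r m)) β N * S (ψ.pmul (r' m)) β N =
      ∑ x ∈ Ioc 0 N ×ˢ Ioc 0 N, tw (ψ.pmul (r m)) β x.1 * tw (ψ.pmul (r' m)) β x.2 := by
    rw [S, S, sum_mul_sum, sum_product]
  rw [← sum_filter_add_sum_filter_not _ (fun x : ℕ × ℕ => x.1 * x.2 ≤ N), ← S_mul, hGG] at hprod
  have hS1 : S (1 : ArithmeticFunction ℝ) β N = 1 := by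
    rw [S, sum_eq_single 1]
    · simp [tw_apply]
    · intro n _ hn
      rw [tw_apply, ArithmeticFunction.one_apply_ne hn, zero_mul]
    · intro h
      exfalso; apply h
      rw [mem_Ioc]; exact ⟨by norm_num, Nat.one_le_pow _ _ hD0⟩
  rw [hS1] at hprod
  set R := ∑ x ∈ Ioc 0 N ×ˢ Ioc 0 N with ¬ x.1 * x.2 ≤ N,
    tw (ψ.pmul (r m)) β x.1 * tw (ψ.pmul (r' m)) β x.2 with hR
  have hRb : |R| ≤ 2 * ((D : ℝ) ^ (-(1/10) : ℝ) * C * C) := by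
    calc |R| ≤ ∑ x ∈ Ioc 0 N ×ˢ Ioc 0 N with ¬ x.1 * x.2 ≤ N, w x.1 * w x.2 := by
          refine (abs_sum_le_sum_abs _ _).trans (sum_le_sum fun x _ => ?_)
          rw [abs_mul]
          exact mul_le_mul (hg1 _) (hg2 _) (abs_nonneg _) (hw0 _)
      _ ≤ ∑ x ∈ (Ioc (D ^ 2) N ×ˢ Ioc 0 N) ∪ (Ioc 0 N ×ˢ Ioc (D ^ 2) N), w x.1 * w x.2 := by
          refine sum_le_sum_of_subset_of_nonneg ?_ fun x _ _ => mul_nonneg (hw0 _) (hw0 _)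
          intro x hx
          simp only [mem_filter, mem_product, mem_Ioc, mem_union] at hx ⊢
          obtain ⟨⟨⟨h1, h2⟩, h3, h4⟩, h5⟩ := hx
          by_cases h : D ^ 2 < x.1
          · exact Or.inl ⟨⟨h, h2⟩, h3, h4⟩
          · right
            refine ⟨⟨h1, h2⟩, ?_, h4⟩
            by_contra h'
            apply h5
            calc x.1 * x.2 ≤ D ^ 2 * D ^ 2 := Nat.mul_le_mul (by omega) (by omega)
              _ = N := by rw [hN]; ring
      _ ≤ ∑ x ∈ (Ioc (D ^ 2) N ×ˢ Ioc 0 N), w x.1 * w x.2 +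
          ∑ x ∈ (Ioc 0 N ×ˢ Ioc (D ^ 2) N), w x.1 * w x.2 := by
          rw [← sum_union_inter]
          exact le_add_of_nonneg_right (sum_nonneg fun x _ => mul_nonneg (hw0 _) (hw0 _))
      _ = 2 * ((∑ n ∈ Ioc (D ^ 2) N, w n) * ∑ n ∈ Ioc 0 N, w n) := by
          rw [sum_product, sum_product, ← sum_mul_sum, ← sum_mul_sum]; ring
      _ ≤ _ := by
          refine mul_le_mul_of_nonneg_left ?_ (by norm_num)
          exact mul_le_mul htail hfull (sum_nonneg fun n _ => hw0 n) (by positivity)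
  have hPQ : |S (ψ.pmul (r m)) β N * S (ψ.pmul (r' m)) β N| ≤
      12 * (4 * a) * (4 * a) * (D : ℝ) ^ (-(8/10) : ℝ) * C := by
    rw [abs_mul]
    exact mul_le_mul hcb hQ (abs_nonneg _) (by positivity)
  rw [hprod] at hPQ
  have h1 := (abs_le.mp hPQ).2
  have h2 := (abs_le.mp hRb).1
  nlinarith

lemma main (d : ℕ) :
    {m : ℤ | m < 0 ∧ Squarefree m ∧
      ∀ [NumberField (Qsqrt m)], NumberField.classNumber (Qsqrt m) = d}.Finite := by
  by_contra hinf
  have hinf : Set.Infinite _ := hinf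
  obtain ⟨C, -, hC⟩ := lemE d
  have hbig : ∀ B : ℕ, ∃ m : ℤ, (m < 0 ∧ Squarefree m ∧
      ∀ [NumberField (Qsqrt m)], NumberField.classNumber (Qsqrt m) = d) ∧ B ≤ m.natAbs := by
    intro B
    by_contra h
    push Not at h
    refine hinf ((Set.finite_Icc (-(B : ℤ)) B).subset fun m hm => ?_)
    have := h m hm
    rw [Set.mem_Icc]; omega
  obtain ⟨B1, hB1⟩ := eventually_atTop.mp (step1 C)
  obtain ⟨m₁, ⟨hm1, hsf1, hcl1⟩, hb1⟩ := hbig B1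
  obtain ⟨β, hβ, h0⟩ := hB1 _ hb1 m₁ hm1 rfl (hC m₁ hm1 hsf1 hcl1)
  obtain ⟨B2, hB2⟩ := eventually_atTop.mp (step2 C m₁ hm1 β hβ h0)
  obtain ⟨m, ⟨hm, hsf, hcl⟩, hb⟩ := hbig B2
  exact hB2 _ hb m hm hsf rfl (hC m hm hsf hcl)
end HB

/-- Heilbronn's theorem: for every positive integer `d`, there are only finitely many
imaginary quadratic fields with class number `d`. -/
theorem stmt_9 (d : ℕ) (hd : 0 < d) :
    {m : ℤ | m < 0 ∧ Squarefree m ∧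
      ∀ [NumberField (Qsqrt m)], NumberField.classNumber (Qsqrt m) = d}.Finite :=
  HB.main d
end

section
/- The elliptic curve y² = x³ + 2 over ℚ has trivial torsion subgroup: the only point of finite order in its group of ℚ-rational points is the point at infinity O. -/
/-- The short Weierstrass curve y^2 = x^3 + Ax + B. -/
def Wshort {K : Type*} [CommRing K] (A B : K) : WeierstrassCurve.Affine K :=
  { a₁ := 0, a₂ := 0, a₃ := 0, a₄ := A, a₆ := B }

lemma val_key (x y : ℚ) (h : y ^ 2 = x ^ 3 + 2) :
    y ≠ 0 ∧ padicValRat 2 ((x ^ 4 - 16 * x) / (4 * y ^ 2)) < padicValRat 2 x := by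
  have : Fact (Nat.Prime 2) := ⟨Nat.prime_two⟩
  have v2 : padicValRat 2 (2 : ℚ) = 1 := by
    exact_mod_cast padicValRat.self (p := 2) (by norm_num)
  have v4 : padicValRat 2 (4 : ℚ) = 2 := by
    rw [show (4 : ℚ) = 2 ^ 2 by norm_num, padicValRat.pow, v2]; norm_num
  have v16 : padicValRat 2 (-16 : ℚ) = 4 := by
    rw [padicValRat.neg, show (16 : ℚ) = 2 ^ 4 by norm_num, padicValRat.pow, v2]; norm_num
  have vy : padicValRat 2 (y ^ 2) = 2 * padicValRat 2 y := by
    rw [padicValRat.pow]; norm_num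
  have vx : padicValRat 2 (x ^ 3) = 3 * padicValRat 2 x := by
    rw [padicValRat.pow]; norm_num
  have hx : x ≠ 0 := by
    rintro rfl
    rw [h] at vy
    norm_num [v2] at vy
    omega
  have hx3 : x ^ 3 ≠ 0 := pow_ne_zero _ hx
  have hA : x ^ 3 + 2 ≠ 0 := by
    intro h0
    rw [show x ^ 3 = -2 by linarith, padicValRat.neg, v2] at vx
    omega
  have hB : x ^ 3 + -16 ≠ 0 := by
    intro h0
    rw [show x ^ 3 = - -16 by linarith, padicValRat.neg, v16] at vx
    omega
  have hy : y ≠ 0 := by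
    rintro rfl
    apply hA
    rw [← h]; norm_num
  refine ⟨hy, ?_⟩
  have hneg : padicValRat 2 x ≤ 0 := by
    by_contra hc
    have := padicValRat.add_eq_of_lt (p := 2) (q := 2) (r := x ^ 3) (by rwa [add_comm])
      (by norm_num) hx3 (by rw [v2, vx]; omega)
    rw [add_comm, ← h, vy, v2] at this
    omega
  have e1 := padicValRat.add_eq_of_lt (p := 2) hA hx3 (by norm_num) (by rw [v2, vx]; omega)
  have e2 := padicValRat.add_eq_of_lt (p := 2) hB hx3 (by norm_num) (by rw [v16, vx]; omega)
  rw [h, show x ^ 4 - 16 * x = x * (x ^ 3 + -16) by ring,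
    padicValRat.div (mul_ne_zero hx hB) (mul_ne_zero (by norm_num) hA),
    padicValRat.mul hx hB, padicValRat.mul (by norm_num) hA, e1, e2, v4]
  omega

def hgt : (Wshort (0 : ℚ) 2).Point → ℤ
  | .zero => 0
  | .some x _ _ => padicValRat 2 x

lemma dbl (P : (Wshort (0 : ℚ) 2).Point) (hP : P ≠ 0) : P + P ≠ 0 ∧ hgt (P + P) < hgt P := by
  rcases P with _ | ⟨x, y, h⟩
  · exact absurd rfl hP
  · have he : y ^ 2 = x ^ 3 + 2 := by
      have := (WeierstrassCurve.Affine.equation_iff _ _).1 h.1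
      simpa [Wshort] using this
    obtain ⟨hy, hv⟩ := val_key x y he
    have hne : y ≠ (Wshort (0 : ℚ) 2).negY x y := by
      simp only [WeierstrassCurve.Affine.negY, Wshort]
      intro h0
      apply hy
      linarith
    rw [WeierstrassCurve.Affine.Point.add_self_of_Y_ne hne]
    refine ⟨WeierstrassCurve.Affine.Point.some_ne_zero _, ?_⟩
    simp only [hgt]
    convert hv using 2
    rw [WeierstrassCurve.Affine.slope_of_Y_ne rfl hne]
    simp only [WeierstrassCurve.Affine.addX, WeierstrassCurve.Affine.negY, Wshort]
    have : y + y ≠ 0 := by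
      intro h0
      apply hy
      linarith
    have h2 : y - (-y - 0 * x - 0) = 2 * y := by ring
    rw [h2]
    field_simp
    linear_combination (-32 * x) * he

theorem stmt_13 : AddCommGroup.torsion (Wshort (0 : ℚ) 2).Point = ⊥ := by
  rw [eq_bot_iff]
  intro P hP
  rw [AddSubgroup.mem_bot]
  by_contra h0
  have hfin : IsOfFinAddOrder P := hP
  have hn : ∀ k : ℕ, (2 ^ k) • P ≠ 0 := by
    intro k
    induction k with
    | zero => simpa using h0
    | succ k ih =>
      rw [pow_succ, mul_two, add_smul]
      exact (dbl _ ih).1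
  have hanti : StrictAnti fun k : ℕ => hgt ((2 ^ k) • P) := by
    apply strictAnti_nat_of_succ_lt
    intro k
    rw [pow_succ, mul_two, add_smul]
    exact (dbl _ (hn k)).2
  have hinj : Function.Injective fun k : ℕ => (2 ^ k) • P := by
    intro a b hab
    apply hanti.injective
    exact congrArg hgt hab
  refine Set.infinite_of_injective_forall_mem hinj (fun k => ?_) hfin.finite_multiples
  exact ⟨2 ^ k, rfl⟩
end

section
/- The torsion subgroup of the group of ℚ-rational points of the elliptic curve y² = x³ + 1 over ℚ is isomorphic to ℤ/6ℤ. -/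
lemma w14_ns_iff (x y : ℚ) : (Wshort (0:ℚ) 1).Nonsingular x y ↔ y^2 = x^3+1 := by
  rw [WeierstrassCurve.Affine.nonsingular_iff, WeierstrassCurve.Affine.equation_iff]
  simp only [Wshort]
  constructor
  · rintro ⟨h, _⟩; linarith
  · intro h
    refine ⟨by linarith, ?_⟩
    by_cases hy : y = 0
    · left
      have : x ≠ 0 := by rintro rfl; simp [hy] at h
      simp only [zero_mul, mul_zero, add_zero]
      exact (by positivity : (3 * x^2 : ℚ) ≠ 0).symm
    · right
      intro h2; apply hy; linarith

lemma w14_dbl (x y : ℚ) (h : (Wshort (0:ℚ) 1).Nonsingular x y) (hy : y ≠ 0) :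
    ∃ x' y', ∃ h' : (Wshort (0:ℚ) 1).Nonsingular x' y',
      (2:ℕ) • WeierstrassCurve.Affine.Point.some x y h = .some x' y' h' ∧
      x' = 9*x^4/(4*(x^3+1)) - 2*x ∧ y' = -y - 3*x^2/(2*y)*(x' - x) := by
  have e := (w14_ns_iff x y).1 h
  have hn : y ≠ (Wshort (0:ℚ) 1).negY x y := by
    simp only [WeierstrassCurve.Affine.negY, Wshort]
    intro h2; apply hy; linarith
  have hs : (Wshort (0:ℚ) 1).slope x x y y = 3*x^2/(2*y) := by
    rw [WeierstrassCurve.Affine.slope_of_Y_ne rfl hn]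
    simp only [WeierstrassCurve.Affine.negY, Wshort]
    congr 1 <;> ring
  rw [two_nsmul, WeierstrassCurve.Affine.Point.add_self_of_Y_ne hn]
  refine ⟨_, _, _, rfl, ?_, ?_⟩
  · rw [hs]
    simp only [WeierstrassCurve.Affine.addX, WeierstrassCurve.Affine.negY, Wshort]
    rw [← e]
    field_simp
    ring
  · rw [hs]
    simp only [WeierstrassCurve.Affine.addX, WeierstrassCurve.Affine.addY, WeierstrassCurve.Affine.negAddY, WeierstrassCurve.Affine.negY, Wshort]
    field_simp
    ring

def w14Bad (x : ℚ) : Prop := x ≠ 0 ∧ (padicValRat 2 x < 0 ∨ 2 ≤ padicValRat 2 x)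

lemma w14_v2 : padicValRat 2 (2:ℚ) = 1 := by
  simpa using padicValRat.self (p := 2) (by norm_num)

lemma w14_v4 : padicValRat 2 (4:ℚ) = 2 := by
  rw [show (4:ℚ) = 2^2 by norm_num, padicValRat.pow, w14_v2]; norm_num

lemma w14_v8 : padicValRat 2 (-8:ℚ) = 3 := by
  rw [padicValRat.neg, show (8:ℚ) = 2^3 by norm_num, padicValRat.pow, w14_v2]; norm_num

lemma w14_cube_add (x : ℚ) (h : x ^ 3 + 1 = 0) : x = -1 := by
  have : (x+1) * ((x-1/2)^2 + 3/4) = 0 := by linear_combination h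
  rcases mul_eq_zero.1 this with h | h
  · linarith
  · nlinarith [sq_nonneg (x-1/2)]

lemma w14_cube_sub (x : ℚ) (h : x ^ 3 + -8 = 0) : x = 2 := by
  have : (x-2) * ((x+1)^2 + 3) = 0 := by linear_combination h
  rcases mul_eq_zero.1 this with h | h
  · linarith
  · nlinarith [sq_nonneg (x+1)]

lemma w14_main (x x' : ℚ) (h0 : x ≠ 0) (h1 : x ^ 3 + 1 ≠ 0) (h2 : x ^ 3 + -8 ≠ 0)
    (hx' : x' = 9*x^4/(4*(x^3+1)) - 2*x) :
    x' ≠ 0 ∧ padicValRat 2 x' = padicValRat 2 x + padicValRat 2 (x^3 + -8) - 2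
      - padicValRat 2 (x^3+1) := by
  have e : x' = x * (x^3 + -8) / (4 * (x^3+1)) := by
    rw [hx']; field_simp; ring
  have hn : x * (x^3 + -8) ≠ 0 := mul_ne_zero h0 h2
  have hd : 4 * (x^3+1) ≠ 0 := mul_ne_zero (by norm_num) h1
  refine ⟨by rw [e]; exact div_ne_zero hn hd, ?_⟩
  rw [e, padicValRat.div hn hd, padicValRat.mul h0 h2, padicValRat.mul (by norm_num) h1, w14_v4]
  ring

lemma w14_bad_step (x x' : ℚ) (hb : w14Bad x)
    (hx' : x' = 9*x^4/(4*(x^3+1)) - 2*x) :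
    w14Bad x' ∧ (padicValRat 2 x).natAbs < (padicValRat 2 x').natAbs := by
  obtain ⟨h0, hv⟩ := hb
  have h1 : x^3+1 ≠ 0 := by
    intro h
    have := w14_cube_add x h
    subst this
    simp at hv
  have h2 : x^3 + -8 ≠ 0 := by
    intro h
    have := w14_cube_sub x h
    subst this
    rw [w14_v2] at hv
    omega
  obtain ⟨hn, hval⟩ := w14_main x x' h0 h1 h2 hx'
  have hc : padicValRat 2 (x^3) = 3 * padicValRat 2 x := by
    rw [padicValRat.pow]; norm_num
  have e1 := padicValRat.add_eq_min (p := 2) h1 (pow_ne_zero 3 h0) one_ne_zero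
    (by rw [hc, padicValRat.one]; omega)
  have e2 := padicValRat.add_eq_min (p := 2) h2 (pow_ne_zero 3 h0) (by norm_num)
    (by rw [hc, w14_v8]; omega)
  rw [hc, padicValRat.one] at e1
  rw [hc, w14_v8] at e2
  refine ⟨⟨hn, ?_⟩, ?_⟩ <;> omega

lemma w14_good_step (x x' : ℚ) (h0 : x ≠ 0) (h1 : x ≠ -1) (h2 : x ≠ 2) (hb : ¬ w14Bad x)
    (hx' : x' = 9*x^4/(4*(x^3+1)) - 2*x) : w14Bad x' := by
  have h1 : x^3+1 ≠ 0 := fun h => h1 (w14_cube_add x h)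
  have h2 : x^3 + -8 ≠ 0 := fun h => h2 (w14_cube_sub x h)
  obtain ⟨hn, hval⟩ := w14_main x x' h0 h1 h2 hx'
  have hc : padicValRat 2 (x^3) = 3 * padicValRat 2 x := by
    rw [padicValRat.pow]; norm_num
  have hv : padicValRat 2 x = 0 ∨ padicValRat 2 x = 1 := by
    unfold w14Bad at hb
    push Not at hb
    have := hb h0
    omega
  refine ⟨hn, ?_⟩
  have m1 := padicValRat.min_le_padicValRat_add (p := 2) h1
  have m2 := padicValRat.min_le_padicValRat_add (p := 2) h2
  rw [hc, padicValRat.one] at m1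
  rw [hc, w14_v8] at m2
  rcases hv with hv | hv
  · have e2 := padicValRat.add_eq_min (p := 2) h2 (pow_ne_zero 3 h0) (by norm_num)
      (by rw [hc, w14_v8]; omega)
    rw [hc, w14_v8] at e2
    omega
  · have e1 := padicValRat.add_eq_min (p := 2) h1 (pow_ne_zero 3 h0) one_ne_zero
      (by rw [hc, padicValRat.one]; omega)
    rw [hc, padicValRat.one] at e1
    omega

lemma w14_y_ne (x y : ℚ) (h : y^2 = x^3+1) (hx : x ≠ -1) : y ≠ 0 := by
  rintro rfl
  exact hx (w14_cube_add x (by linarith))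

lemma w14_iter (x y : ℚ) (h : (Wshort (0:ℚ) 1).Nonsingular x y) (hb : w14Bad x) (n : ℕ) :
    ∃ x' y', ∃ h' : (Wshort (0:ℚ) 1).Nonsingular x' y',
      (2^n:ℕ) • WeierstrassCurve.Affine.Point.some x y h = .some x' y' h' ∧ w14Bad x' ∧
      (padicValRat 2 x).natAbs + n ≤ (padicValRat 2 x').natAbs := by
  induction n with
  | zero => exact ⟨x, y, h, by simp, hb, by simp⟩
  | succ n ih =>
    obtain ⟨x', y', h', e, hb', hle⟩ := ih
    have hx' : x' ≠ -1 := by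
      rintro rfl
      have := hb'.2
      simp at this
    obtain ⟨x2, y2, h2, e2, f2, -⟩ := w14_dbl x' y' h'
      (w14_y_ne x' y' ((w14_ns_iff _ _).1 h') hx')
    obtain ⟨b2, l2⟩ := w14_bad_step x' x2 hb' f2
    refine ⟨x2, y2, h2, ?_, b2, by omega⟩
    rw [pow_succ', mul_smul, e, e2]

lemma w14_bad_not_tors (x y : ℚ) (h : (Wshort (0:ℚ) 1).Nonsingular x y) (hb : w14Bad x) :
    ¬ IsOfFinAddOrder (WeierstrassCurve.Affine.Point.some x y h) := by
  intro ht
  have hfin : (Set.range fun n : ℕ => (2^n:ℕ) • WeierstrassCurve.Affine.Point.some x y h).Finite := by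
    refine Set.Finite.subset (finite_multiples.2 ht) ?_
    rintro _ ⟨n, rfl⟩
    exact ⟨2^n, rfl⟩
  let g : (Wshort (0:ℚ) 1).Point → ℕ := fun P => match P with
    | .zero => 0
    | .some x _ _ => (padicValRat 2 x).natAbs
  obtain ⟨M, hM⟩ := (hfin.image g).bddAbove
  obtain ⟨x', y', h', e, -, hle⟩ := w14_iter x y h hb (M+1)
  have := hM ⟨_, ⟨M+1, rfl⟩, rfl⟩
  simp only [e] at this
  change (padicValRat 2 x').natAbs ≤ M at this
  omega

lemma w14_tors (x y : ℚ) (h : (Wshort (0:ℚ) 1).Nonsingular x y)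
    (ht : IsOfFinAddOrder (WeierstrassCurve.Affine.Point.some x y h)) :
    x = 0 ∨ x = -1 ∨ x = 2 := by
  by_contra! hc
  obtain ⟨h0, h1, h2⟩ := hc
  have hb : ¬ w14Bad x := fun hb => w14_bad_not_tors x y h hb ht
  obtain ⟨x2, y2, hh2, e2, f2, -⟩ := w14_dbl x y h (w14_y_ne x y ((w14_ns_iff _ _).1 h) h1)
  have := w14_good_step x x2 h0 h1 h2 hb f2
  apply w14_bad_not_tors x2 y2 hh2 this
  rw [← e2]
  exact ht.nsmul

theorem stmt_14 :
    Nonempty (AddCommGroup.torsion (Wshort (0 : ℚ) 1).Point ≃+ ZMod 6) := by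
  have hG : (Wshort (0:ℚ) 1).Nonsingular 2 3 := (w14_ns_iff _ _).2 (by norm_num)
  have h01 : (Wshort (0:ℚ) 1).Nonsingular 0 1 := (w14_ns_iff _ _).2 (by norm_num)
  have h10 : (Wshort (0:ℚ) 1).Nonsingular (-1) 0 := (w14_ns_iff _ _).2 (by norm_num)
  let G : (Wshort (0:ℚ) 1).Point := .some 2 3 hG
  have e2 : (2:ℕ) • G = .some 0 1 h01 := by
    obtain ⟨x', y', h', e, ex, ey⟩ := w14_dbl 2 3 hG (by norm_num)
    have hx : x' = 0 := by rw [ex]; norm_num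
    have hy : y' = 1 := by rw [ey, hx]; norm_num
    subst hx hy
    exact e
  have e3 : (3:ℕ) • G = .some (-1) 0 h10 := by
    rw [show (3:ℕ) = 2 + 1 from rfl, add_nsmul, e2, one_nsmul]
    have hne : (0:ℚ) ≠ 2 := by norm_num
    rw [WeierstrassCurve.Affine.Point.add_of_X_ne hne]
    congr 1 <;>
    · simp only [WeierstrassCurve.Affine.addX, WeierstrassCurve.Affine.addY,
        WeierstrassCurve.Affine.negAddY, WeierstrassCurve.Affine.negY,
        WeierstrassCurve.Affine.slope_of_X_ne hne, Wshort]
      norm_num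
  have e6 : (6:ℕ) • G = 0 := by
    rw [show (6:ℕ) = 2 * 3 from rfl, mul_smul, e3, two_nsmul]
    apply WeierstrassCurve.Affine.Point.add_self_of_Y_eq
    simp [WeierstrassCurve.Affine.negY, Wshort]
  have hord : addOrderOf G = 6 := by
    apply addOrderOf_eq_of_nsmul_and_div_prime_nsmul (by norm_num) e6
    intro p hp hd
    have : p ≤ 6 := Nat.le_of_dvd (by norm_num) hd
    interval_cases p <;> first
      | (exfalso; revert hp; norm_num; done)
      | (exfalso; revert hd; norm_num; done)
      | skip
    · change (3:ℕ) • G ≠ 0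
      rw [e3]; exact WeierstrassCurve.Affine.Point.some_ne_zero _
    · change (2:ℕ) • G ≠ 0
      rw [e2]; exact WeierstrassCurve.Affine.Point.some_ne_zero _
  have hneg : ∀ x y (h : (Wshort (0:ℚ) 1).Nonsingular x y)
      (h' : (Wshort (0:ℚ) 1).Nonsingular x (-y)),
      WeierstrassCurve.Affine.Point.some x (-y) h' = - .some x y h := by
    intro x y h h'
    rw [WeierstrassCurve.Affine.Point.neg_some]
    congr 1
    simp [WeierstrassCurve.Affine.negY, Wshort]
  have hall : ∀ P : (Wshort (0:ℚ) 1).Point, IsOfFinAddOrder P → P ∈ AddSubgroup.zmultiples G := by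
    have m1 : G ∈ AddSubgroup.zmultiples G := AddSubgroup.mem_zmultiples G
    have m2 := AddSubgroup.nsmul_mem _ m1 2
    have m3 := AddSubgroup.nsmul_mem _ m1 3
    rw [e2] at m2
    rw [e3] at m3
    rintro (_ | ⟨x, y, h⟩) ht
    · exact AddSubgroup.zero_mem _
    have e := (w14_ns_iff _ _).1 h
    rcases w14_tors x y h ht with rfl | rfl | rfl
    · have : y = 1 ∨ y = -1 := sq_eq_sq_iff_eq_or_eq_neg.1 (by linarith)
      rcases this with rfl | rfl
      · exact m2
      · rw [hneg 0 1 h01]; exact AddSubgroup.neg_mem _ m2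
    · have : y = 0 := by
        apply pow_eq_zero_iff (two_ne_zero) |>.1; linarith
      subst this
      exact m3
    · have : y = 3 ∨ y = -3 := sq_eq_sq_iff_eq_or_eq_neg.1 (by linarith)
      rcases this with rfl | rfl
      · exact m1
      · rw [hneg 2 3 hG]; exact AddSubgroup.neg_mem _ m1
  have heq : AddCommGroup.torsion (Wshort (0 : ℚ) 1).Point = AddSubgroup.zmultiples G := by
    apply le_antisymm
    · intro P hP
      exact hall P hP
    · rw [AddSubgroup.zmultiples_le]
      change IsOfFinAddOrder G
      exact isOfFinAddOrder_iff_nsmul_eq_zero.2 ⟨6, by norm_num, e6⟩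
  rw [heq]
  have hcard : Nat.card (AddSubgroup.zmultiples G) = 6 := by
    rw [Nat.card_zmultiples, hord]
  have := zmodAddCyclicAddEquiv (G := AddSubgroup.zmultiples G) inferInstance
  rw [hcard] at this
  exact ⟨this.symm⟩
end

section
/- The torsion subgroup of the group of ℚ-rational points of the elliptic curve y² = x³ − 4x over ℚ is isomorphic to (ℤ/2ℤ) × (ℤ/2ℤ), and the torsion subgroup of the group of ℚ-rational points of the elliptic curve y² = x³ + 4x over ℚ is isomorphic to ℤ/4ℤ. -/
theorem sq_of_cop {a b c : ℤ} (h : IsCoprime a b) (ha : 0 ≤ a) (e : a * b = c ^ 2) : ∃ d, a = d ^ 2 := by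
  obtain ⟨d, hd | hd⟩ := Int.sq_of_isCoprime h e
  · exact ⟨d, hd⟩
  · exact ⟨0, by nlinarith [sq_nonneg d]⟩

/-- t^2 + 4 s^4 case -/
theorem descent_aux (x s t : ℤ) (hx : 0 < x) (hs : s ≠ 0) (hc : IsCoprime t (2 * s))
    (h : t ^ 4 + 4 * s ^ 4 = x ^ 2) :
    ∃ p q r : ℤ, 0 < p ∧ p < x ∧ q ≠ 0 ∧ IsCoprime p q ∧ p ^ 4 - q ^ 4 = r ^ 2 ∧ r = t := by
  have ht : t ^ 2 % 2 = 1 := by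
    rcases Int.emod_two_eq_zero_or_one t with h0 | h0
    · exfalso
      have h2 : IsCoprime t 2 := hc.of_isCoprime_of_dvd_right (Dvd.intro _ rfl)
      have := h2.isUnit_of_dvd' (Int.dvd_of_emod_eq_zero h0) dvd_rfl
      exact absurd this (by decide)
    · simp [pow_two, Int.mul_emod, h0]
  have hpt : PythagoreanTriple (t ^ 2) (2 * s ^ 2) x := by
    unfold PythagoreanTriple; linear_combination h
  have hc2 : IsCoprime (t ^ 2) (2 * s ^ 2) := by
    have h2 : IsCoprime t 2 := hc.of_isCoprime_of_dvd_right (Dvd.intro _ rfl)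
    have h3 : IsCoprime t s := hc.of_isCoprime_of_dvd_right (Dvd.intro_left _ rfl)
    exact (h2.mul_right (h3.pow_right)).pow_left
  obtain ⟨m, n, e1, e2, e3, hg, -, hm⟩ :=
    hpt.coprime_classification' (Int.isCoprime_iff_gcd_eq_one.1 hc2) ht hx
  have e2' : m * n = s ^ 2 := by linarith
  have hmn : IsCoprime m n := Int.isCoprime_iff_gcd_eq_one.2 hg
  have hs2 : 0 < s ^ 2 := by positivity
  have hm' : 0 < m := lt_of_le_of_ne hm (by rintro rfl; simp at e2'; exact hs2.ne e2')
  have hn' : 0 < n := by by_contra hh; nlinarith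
  obtain ⟨p, hp⟩ := sq_of_cop hmn hm e2'
  obtain ⟨q, hq⟩ := sq_of_cop hmn.symm hn'.le (by rw [mul_comm]; exact e2')
  subst hp hq
  have hp0 : p ≠ 0 := by rintro rfl; simp at hm'
  have hq0 : q ≠ 0 := by rintro rfl; simp at hn'
  have hpc : IsCoprime p q := (IsCoprime.pow_iff two_pos two_pos).1 hmn
  refine ⟨|p|, q, t, abs_pos.2 hp0, ?_, hq0, ?_, ?_, rfl⟩
  · have h1 : |p| ^ 2 = p ^ 2 := sq_abs p
    have := abs_pos.2 hp0
    have : |p| ≤ |p| ^ 2 := by nlinarith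
    nlinarith
  · exact hpc.abs_left
  · have : |p| ^ 4 = p ^ 4 := by rw [show 4 = 2 * 2 from rfl, pow_mul, pow_mul, sq_abs]
    rw [this]; linear_combination -e1

theorem descent (N : ℕ) : ∀ x y z : ℤ, x.natAbs ≤ N → 0 < x → IsCoprime x y → y ≠ 0 → z ≠ 0 →
    x ^ 4 - y ^ 4 ≠ z ^ 2 := by
  induction N with
  | zero => intro x y z h h0; omega
  | succ N ih =>
  intro x y z hN hx hc hy hz h
  have hcz : IsCoprime (y ^ 2) z := by
    have : IsCoprime (y ^ 2) (z ^ 2) := by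
      rw [← h, show x ^ 4 - y ^ 4 = x ^ 4 + y ^ 2 * (- y ^ 2) by ring]
      exact (hc.symm.pow).add_mul_left_right _
    exact (IsCoprime.pow_right_iff two_pos).1 this
  have hx2 : 0 < x ^ 2 := by positivity
  rcases Int.emod_two_eq_zero_or_one y with h0 | h0
  · have hz1 : z % 2 = 1 := by
      rcases Int.emod_two_eq_zero_or_one z with h1 | h1
      · exfalso
        have := hcz.isUnit_of_dvd' (dvd_pow (Int.dvd_of_emod_eq_zero h0) two_ne_zero)
          (Int.dvd_of_emod_eq_zero h1)
        exact absurd this (by decide)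
      · exact h1
    have hpt : PythagoreanTriple z (y ^ 2) (x ^ 2) := by
      unfold PythagoreanTriple; linear_combination -h
    obtain ⟨m, n, e1, e2, e3, hg, hpar, hm⟩ :=
      hpt.coprime_classification' (Int.isCoprime_iff_gcd_eq_one.1 hcz.symm) hz1 hx2
    have hmn : IsCoprime m n := Int.isCoprime_iff_gcd_eq_one.2 hg
    have hy2 : 0 < y ^ 2 := by positivity
    have hm' : 0 < m := lt_of_le_of_ne hm (by rintro rfl; simp at e2; exact hy e2)
    have hn' : 0 < n := by by_contra hh; nlinarith
    have key : ∀ m n : ℤ, 0 < m → 0 < n → IsCoprime m n → m % 2 = 0 → n % 2 = 1 →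
        y ^ 2 = 2 * m * n → x ^ 2 = m ^ 2 + n ^ 2 → False := by
      intro m n hm hn hmn hpm hpn e2 e3
      obtain ⟨k, rfl⟩ := Int.dvd_of_emod_eq_zero hpm
      obtain ⟨w, rfl⟩ := Int.dvd_of_emod_eq_zero h0
      have e : k * n = w ^ 2 := by linarith
      have hkn : IsCoprime k n := hmn.of_isCoprime_of_dvd_left (Dvd.intro_left _ rfl)
      have h2n : IsCoprime 2 n := hmn.of_isCoprime_of_dvd_left (Dvd.intro _ rfl)
      obtain ⟨s, rfl⟩ := sq_of_cop hkn (by linarith) e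
      obtain ⟨t, rfl⟩ := sq_of_cop hkn.symm hn.le (by rw [mul_comm]; exact e)
      have hs : s ≠ 0 := by rintro rfl; simp at hm
      have ht : t ≠ 0 := by rintro rfl; simp at hn
      have hst := (IsCoprime.pow_iff two_pos two_pos).1 hkn
      have h2t := (IsCoprime.pow_right_iff two_pos).1 h2n
      obtain ⟨p, q, r, hp, hpx, hq, hpq, e4, e5⟩ := descent_aux x s t hx hs
        (h2t.symm.mul_right hst.symm) (by linear_combination -e3)
      exact ih p q r (by omega) hp hpq hq (by rw [e5]; exact ht) e4
    rcases hpar with ⟨h1, h2⟩ | ⟨h1, h2⟩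
    · exact key m n hm' hn' hmn h1 h2 e2 e3
    · exact key n m hn' hm' hmn.symm h2 h1 (by linarith) (by linarith)
  · have hpt : PythagoreanTriple (y ^ 2) z (x ^ 2) := by
      unfold PythagoreanTriple; linear_combination -h
    obtain ⟨m, n, e1, e2, e3, hg, hpar, hm⟩ :=
      hpt.coprime_classification' (Int.isCoprime_iff_gcd_eq_one.1 hcz)
        (by simp [pow_two, Int.mul_emod, h0]) hx2
    have hmn : IsCoprime m n := Int.isCoprime_iff_gcd_eq_one.2 hg
    have hm' : 0 < m := lt_of_le_of_ne hm (by rintro rfl; simp at e2; exact hz e2)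
    have hn' : n ≠ 0 := by rintro rfl; simp at e2; exact hz e2
    have hn2 : 0 < n ^ 2 := by positivity
    have hlt : m < x := by nlinarith
    exact ih m n (x * y) (by omega) hm' hmn hn' (by positivity)
      (by rw [mul_pow, e1, e3]; ring)

theorem quartic_minus (u w : ℚ) (h : u ^ 4 - 1 = w ^ 2) : w = 0 := by
  by_contra hw
  have hd : (u.den : ℚ) ≠ 0 := by exact_mod_cast u.den_nz
  have hu : (u.num : ℚ) = u * u.den := (Rat.mul_den_eq_num u).symm
  have e : ((u.num ^ 4 - (u.den : ℤ) ^ 4 : ℤ) : ℚ) = (w * u.den ^ 2) ^ 2 := by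
    push_cast; rw [hu]; linear_combination (u.den : ℚ) ^ 4 * h
  have hs : IsSquare ((u.num ^ 4 - (u.den : ℤ) ^ 4 : ℤ) : ℚ) := ⟨_, by rw [e, pow_two]⟩
  rw [Rat.isSquare_intCast_iff] at hs
  obtain ⟨z, hz⟩ := hs
  have hz0 : z ≠ 0 := by
    rintro rfl
    rw [hz] at e
    have : w * (u.den : ℚ) ^ 2 ≠ 0 := by positivity
    exact this (pow_eq_zero_iff two_ne_zero |>.1 (by rw [← e]; simp))
  have hn : u.num ≠ 0 := by
    intro h0; rw [h0] at hz
    have : 0 < (u.den : ℤ) ^ 4 := by have := u.den_pos; positivity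
    nlinarith
  refine descent _ |u.num| u.den z le_rfl (abs_pos.2 hn) ?_ (by exact_mod_cast u.den_nz) hz0 ?_
  · apply IsCoprime.abs_left
    rw [Int.isCoprime_iff_gcd_eq_one]; exact u.reduced
  · have : |u.num| ^ 4 = u.num ^ 4 := by rw [show 4 = 2 * 2 from rfl, pow_mul, pow_mul, sq_abs]
    rw [this, hz]; ring

theorem quartic_plus (u w : ℚ) (h : u ^ 4 + 1 = w ^ 2) : u = 0 := by
  by_contra hw
  have hd : (u.den : ℚ) ≠ 0 := by exact_mod_cast u.den_nz
  have hu : (u.num : ℚ) = u * u.den := (Rat.mul_den_eq_num u).symm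
  have e : ((u.num ^ 4 + (u.den : ℤ) ^ 4 : ℤ) : ℚ) = (w * u.den ^ 2) ^ 2 := by
    push_cast; rw [hu]; linear_combination (u.den : ℚ) ^ 4 * h
  have hs : IsSquare ((u.num ^ 4 + (u.den : ℤ) ^ 4 : ℤ) : ℚ) := ⟨_, by rw [e, pow_two]⟩
  rw [Rat.isSquare_intCast_iff] at hs
  obtain ⟨z, hz⟩ := hs
  exact not_fermat_42 (b := (u.den : ℤ)) (c := z) (Rat.num_ne_zero.2 hw) (by exact_mod_cast u.den_nz) (by rw [hz]; ring)

theorem curve1 (x y : ℚ) (h : y ^ 2 = x ^ 3 - 4 * x) : y = 0 ∧ (x = 0 ∨ x = 2 ∨ x = -2) := by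
  have hy : y = 0 := by
    by_cases hx : x = 0
    · subst hx; simpa using h
    · have := quartic_plus (y / (2 * x)) ((x ^ 2 + 4) / (4 * x)) (by
        have : y ^ 4 = (x ^ 3 - 4 * x) ^ 2 := by rw [← h]; ring
        field_simp; rw [this]; ring)
      simpa [hx] using this
  refine ⟨hy, ?_⟩
  subst hy
  have : x * ((x - 2) * (x + 2)) = 0 := by linear_combination -h
  rcases mul_eq_zero.1 this with h | h
  · exact Or.inl h
  · rcases mul_eq_zero.1 h with h | h
    · right; left; linarith
    · right; right; linarith

theorem curve2 (x y : ℚ) (h : y ^ 2 = x ^ 3 + 4 * x) :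
    (x = 0 ∧ y = 0) ∨ (x = 2 ∧ y = 4) ∨ (x = 2 ∧ y = -4) := by
  by_cases hx : x = 0
  · subst hx; left; simpa using h
  · have := quartic_minus (y / (2 * x)) ((x ^ 2 - 4) / (4 * x)) (by
        have : y ^ 4 = (x ^ 3 + 4 * x) ^ 2 := by rw [← h]; ring
        field_simp; rw [this]; ring)
    have h4 : (x - 2) * (x + 2) = 0 := by
      have : x ^ 2 - 4 = 0 := by simpa [hx] using this
      linear_combination this
    right
    rcases mul_eq_zero.1 h4 with h4 | h4
    · obtain rfl : x = 2 := by linarith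
      have : (y - 4) * (y + 4) = 0 := by linear_combination h
      rcases mul_eq_zero.1 this with h | h
      · left; exact ⟨rfl, by linarith⟩
      · right; exact ⟨rfl, by linarith⟩
    · obtain rfl : x = -2 := by linarith
      nlinarith [sq_nonneg y]

theorem card_four_of {G : Type*} (a b c d : G) (h1 : a ≠ b) (h2 : a ≠ c) (h3 : a ≠ d) (h4 : b ≠ c)
    (h5 : b ≠ d) (h6 : c ≠ d) (h : ∀ x, x = a ∨ x = b ∨ x = c ∨ x = d) : Nat.card G = 4 := by
  classical
  have : (Set.univ : Set G) = (({a, b, c, d} : Finset G) : Set G) := by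
    ext x; simpa using h x
  rw [← Set.ncard_univ, this, Set.ncard_coe_finset]
  simp [Finset.card_insert_of_notMem, *]

theorem torsion_equiv {G : Type*} [AddCommGroup G] (h : Nat.card G = 4) :
    Nonempty (AddCommGroup.torsion G ≃+ G) := by
  have : Finite G := Nat.finite_of_card_ne_zero (by omega)
  have ht : AddCommGroup.torsion G = ⊤ := by
    rw [eq_top_iff]
    intro x _
    exact isOfFinAddOrder_of_finite x
  rw [ht]
  exact ⟨AddSubgroup.topEquiv⟩

theorem ns_iff (A x y : ℚ) (hA : A ≠ 0) :
    (Wshort A 0).Nonsingular x y ↔ y ^ 2 = x ^ 3 + A * x := by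
  rw [WeierstrassCurve.Affine.nonsingular_iff, WeierstrassCurve.Affine.equation_iff]
  simp only [Wshort]
  constructor
  · rintro ⟨h, -⟩; linear_combination h
  · intro h
    refine ⟨by linear_combination h, ?_⟩
    by_contra hh
    push Not at hh
    obtain ⟨h1, h2⟩ := hh
    have hy : y = 0 := by linarith
    subst hy
    have h3 : x * (x ^ 2 + A) = 0 := by linear_combination -h
    have h4 : 3 * x ^ 2 + A = 0 := by linear_combination -h1
    rcases mul_eq_zero.1 h3 with h | h
    · subst h; apply hA; linarith
    · apply hA; linarith

open WeierstrassCurve.Affine in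
theorem part1 : Nonempty (AddCommGroup.torsion (Wshort (-4 : ℚ) 0).Point ≃+ (ZMod 2 × ZMod 2)) := by
  have hA : (-4 : ℚ) ≠ 0 := by norm_num
  have n0 := (ns_iff (-4) 0 0 hA).2 (by norm_num)
  have n1 := (ns_iff (-4) 2 0 hA).2 (by norm_num)
  have n2 := (ns_iff (-4) (-2) 0 hA).2 (by norm_num)
  have all : ∀ P : (Wshort (-4 : ℚ) 0).Point, P = Point.zero ∨ P = Point.some _ _ n0 ∨
      P = Point.some _ _ n1 ∨ P = Point.some _ _ n2 := by
    rintro (_ | ⟨x, y, h⟩)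
    · exact Or.inl rfl
    · obtain ⟨rfl, rfl | rfl | rfl⟩ := curve1 x y (by rw [(ns_iff _ x y hA).1 h]; ring) <;> simp
  have hcard := card_four_of _ _ _ _ (by simp) (by simp) (by simp) (by simp) (by simp)
    (by simp only [ne_eq, Point.some.injEq]; norm_num) all
  obtain ⟨e⟩ := torsion_equiv hcard
  have hneg : ∀ P : (Wshort (-4 : ℚ) 0).Point, 2 • P = 0 := by
    intro P
    rw [two_nsmul, add_eq_zero_iff_eq_neg]
    rcases all P with h | h | h | h <;> rw [h] <;> first | rfl | (rw [Point.neg_some]; simp [negY, Wshort])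
  have hk : IsAddKleinFour (Wshort (-4 : ℚ) 0).Point := by
    refine ⟨hcard, ?_⟩
    have hd := AddMonoid.exponent_dvd_of_forall_nsmul_eq_zero hneg
    rcases (Nat.dvd_prime Nat.prime_two).1 hd with h | h
    · exfalso
      have := AddMonoid.exp_eq_one_iff.1 h
      rw [Nat.card_of_subsingleton (0 : (Wshort (-4 : ℚ) 0).Point)] at hcard
      omega
    · exact h
  obtain ⟨f⟩ := IsAddKleinFour.nonempty_addEquiv (G₁ := (Wshort (-4 : ℚ) 0).Point) (G₂ := ZMod 2 × ZMod 2)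
  exact ⟨e.trans f⟩

open WeierstrassCurve.Affine in
theorem part2 : Nonempty (AddCommGroup.torsion (Wshort (4 : ℚ) 0).Point ≃+ ZMod 4) := by
  have hA : (4 : ℚ) ≠ 0 := by norm_num
  have n0 := (ns_iff (4) 0 0 hA).2 (by norm_num)
  have n1 := (ns_iff (4) 2 4 hA).2 (by norm_num)
  have n2 := (ns_iff (4) 2 (-4) hA).2 (by norm_num)
  have all : ∀ P : (Wshort (4 : ℚ) 0).Point, P = Point.zero ∨ P = Point.some _ _ n0 ∨
      P = Point.some _ _ n1 ∨ P = Point.some _ _ n2 := by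
    rintro (_ | ⟨x, y, h⟩)
    · exact Or.inl rfl
    · obtain ⟨rfl, rfl⟩ | ⟨rfl, rfl⟩ | ⟨rfl, rfl⟩ := curve2 x y ((ns_iff _ x y hA).1 h) <;> simp
  have hcard := card_four_of _ _ _ _ (by simp) (by simp) (by simp) (by simp) (by simp)
    (by simp only [ne_eq, Point.some.injEq]; norm_num) all
  obtain ⟨e⟩ := torsion_equiv hcard
  have : Finite (Wshort (4 : ℚ) 0).Point := Nat.finite_of_card_ne_zero (by omega)
  have ho : addOrderOf (Point.some _ _ n1) = Nat.card (Wshort (4 : ℚ) 0).Point := by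
    have hd := addOrderOf_dvd_natCard (Point.some _ _ n1)
    have h2 : ¬ addOrderOf (Point.some _ _ n1) ∣ 2 := by
      rw [addOrderOf_dvd_iff_nsmul_eq_zero, two_nsmul, add_eq_zero_iff_eq_neg, Point.neg_some,
        Point.some.injEq]
      simp only [negY, Wshort]
      norm_num
    rw [hcard] at hd ⊢
    have hle := Nat.le_of_dvd (by norm_num) hd
    generalize addOrderOf (Point.some _ _ n1) = k at *
    interval_cases k <;> omega
  have hc := isAddCyclic_of_addOrderOf_eq_card _ ho
  have f := zmodAddCyclicAddEquiv hc
  rw [hcard] at f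
  exact ⟨e.trans f.symm⟩

theorem stmt_15 :
    Nonempty (AddCommGroup.torsion (Wshort (-4 : ℚ) 0).Point ≃+ (ZMod 2 × ZMod 2)) ∧
    Nonempty (AddCommGroup.torsion (Wshort (4 : ℚ) 0).Point ≃+ ZMod 4) := ⟨part1, part2⟩
end
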